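/- arXiv:0810.4216 — 3 statements merged into one kernel-verified Lean document; each statement's English description precedes it below -/
import Mathlib

section
/- There exists a constant C > 0, depending only on κ_1,…,κ_d, such that for every measurable function f on ℝ^d and every x ∈ ℝ^d_reg, M_κ^Q f(x) ≤ C M_κ^R f(x). -/
noncomputable section
open MeasureTheory Set Real
open scoped ENNReal NNReal

/-- one-dimensional measure `dμ_κ(x) = |x|^{2κ} dx` -/
def muK1 (κ : ℝ) : Measure ℝ :=
  volume.withDensity fun x => ENNReal.ofReal (|x| ^ (2 * κ))

/-- the measure `μ_κ` on `ℝ^d` with density `∏_j |x_j|^{2κ_j}` -/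
def muK (d : ℕ) (κ : Fin d → ℝ) : Measure (Fin d → ℝ) :=
  volume.withDensity fun x => ENNReal.ofReal (∏ j, |x j| ^ (2 * κ j))

/-- the constant `M_κ = Γ(κ+1/2)/(Γ(κ)Γ(1/2))` -/
def Mconst (κ : ℝ) : ℝ := Real.Gamma (κ + 1/2) / (Real.Gamma κ * Real.Gamma (1/2))

/-- `σ_{x,y,z}` -/
def sigma3 (x y z : ℝ) : ℝ := if x ≠ 0 ∧ y ≠ 0 then (x^2 + y^2 - z^2) / (2*x*y) else 0

/-- area of the (possibly degenerate) triangle with side lengths `x,y,z` (Heron) -/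
def triArea (x y z : ℝ) : ℝ :=
  Real.sqrt (((x+y+z)/2) * ((x+y+z)/2 - x) * ((x+y+z)/2 - y) * ((x+y+z)/2 - z))

/-- the kernel `K_κ(x,y,z)` -/
def Kker (κ x y z : ℝ) : ℝ :=
  if |x - y| ≤ z ∧ z ≤ x + y then
    (2:ℝ) ^ (2*κ - 2) * Mconst κ * triArea x y z ^ (2*κ - 2) * (x*y*z) ^ (1 - 2*κ)
  else 0

/-- density of the measure `ν^{κ,+}_{x,y}` with respect to Lebesgue measure -/
def nuDens (κ x y z : ℝ) : ℝ≥0∞ :=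
  ENNReal.ofReal ((1/2) * Kker κ |x| |y| |z| * (1 - sigma3 x y z) * |z| ^ (2*κ))

/-- the measure `ν^{κ,+}_{x,y}` -/
def nuPlus (κ x y : ℝ) : Measure ℝ := volume.withDensity (nuDens κ x y)

/-- the product measure `υ^κ_{x,y} = ν^{κ_1,+}_{x_1,y_1} ⊗ ⋯ ⊗ ν^{κ_d,+}_{x_d,y_d}` -/
def upsilon (d : ℕ) (κ x y : Fin d → ℝ) : Measure (Fin d → ℝ) :=
  volume.withDensity fun z => ∏ j, nuDens (κ j) (x j) (y j) (z j)

/-- the set `ℝ^d_reg` of regular points -/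
def regSet (d : ℕ) : Set (Fin d → ℝ) := {x | ∀ j, x j ≠ 0}

/-- the Euclidean ball of radius `r` centered at the origin -/
def eBall (d : ℕ) (r : ℝ) : Set (Fin d → ℝ) := {x | ∑ j, (x j)^2 < r^2}

/-- the open cube `Q_r` -/
def cubeQ (d : ℕ) (r : ℝ) : Set (Fin d → ℝ) := {x | ∀ j, |x j| < r}

/-- the constant `c_κ` with `c_κ⁻¹ = ∫ e^{-‖x‖²/2} dμ_κ` -/
def cKappa (d : ℕ) (κ : Fin d → ℝ) : ℝ :=
  (∫ x, Real.exp (-(∑ j, (x j)^2) / 2) ∂(muK d κ))⁻¹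

open Classical in
/-- the `ℤ_2^d` Dunkl maximal operator (explicit form), vanishing off `ℝ^d_reg` -/
def Mdunkl (d : ℕ) (κ : Fin d → ℝ) (f : (Fin d → ℝ) → ℝ) (x : Fin d → ℝ) : ℝ≥0∞ :=
  if x ∈ regSet d then
    ⨆ (r : ℝ) (_ : 0 < r), ENNReal.ofReal
      ((cKappa d κ / (muK d κ (eBall d r)).toReal) *
        |∫ y in regSet d, f y * (upsilon d κ x (-y) (eBall d r)).toReal ∂(muK d κ)|)
  else 0

/-- the cube Dunkl maximal operator `M_κ^Q` (explicit form) -/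
def MdunklQ (d : ℕ) (κ : Fin d → ℝ) (f : (Fin d → ℝ) → ℝ) (x : Fin d → ℝ) : ℝ≥0∞ :=
  ⨆ (r : ℝ) (_ : 0 < r), ENNReal.ofReal
    ((cKappa d κ / (muK d κ (cubeQ d r)).toReal) *
      |∫ y in regSet d, f y * (upsilon d κ x (-y) (cubeQ d r)).toReal ∂(muK d κ)|)

/-- the interval `I(x,r) = [max{0,|x|-r}, |x|+r)` -/
def Iset (x r : ℝ) : Set ℝ := Set.Ico (max 0 (|x| - r)) (|x| + r)

/-- the rectangle `R(z,r) = I(z_1,r) × ⋯ × I(z_d,r)` -/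
def Rset (d : ℕ) (z : Fin d → ℝ) (r : ℝ) : Set (Fin d → ℝ) :=
  Set.univ.pi fun j => Iset (z j) r

/-- the weighted maximal operator `M_κ^R` -/
def MR (d : ℕ) (κ : Fin d → ℝ) (f : (Fin d → ℝ) → ℝ) (x : Fin d → ℝ) : ℝ≥0∞ :=
  ⨆ (r : ℝ) (_ : 0 < r),
    (muK d κ (Rset d x r))⁻¹ *
      ∫⁻ y in {y | (fun j => |y j|) ∈ Rset d x r}, ENNReal.ofReal |f y| ∂(muK d κ)

/-- Rösler's explicit formula for the one-dimensional Dunkl translation `τ_x^κ f(y)` -/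
def tauK (κ x : ℝ) (f : ℝ → ℝ) (y : ℝ) : ℝ :=
  (1/2) * (∫ t in Set.Ioo (-1:ℝ) 1,
      f (Real.sqrt (x^2 + y^2 + 2*x*y*t)) *
        (1 + (x + y) / Real.sqrt (x^2 + y^2 + 2*x*y*t)) *
        (Mconst κ * (1 + t) * (1 - t^2) ^ (κ - 1)))
  + (1/2) * (∫ t in Set.Ioo (-1:ℝ) 1,
      f (-Real.sqrt (x^2 + y^2 + 2*x*y*t)) *
        (1 - (x + y) / Real.sqrt (x^2 + y^2 + 2*x*y*t)) *
        (Mconst κ * (1 + t) * (1 - t^2) ^ (κ - 1)))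

/-- an `ℝ≥0∞`-valued `L^p` norm for `ℝ≥0∞`-valued functions -/
def lpNormE {α : Type*} [MeasurableSpace α] (g : α → ℝ≥0∞) (p : ℝ≥0∞) (μ : Measure α) : ℝ≥0∞ :=
  if p = ∞ then essSup g μ else (∫⁻ x, g x ^ p.toReal ∂μ) ^ (1 / p.toReal)

/-- the Hardy–Littlewood maximal operator over cubes centered at `x` -/
def HLmax (d : ℕ) (f : (Fin d → ℝ) → ℝ) (x : Fin d → ℝ) : ℝ≥0∞ :=
  ⨆ (r : ℝ) (_ : 0 < r),
    (volume {y : Fin d → ℝ | ∀ j, |y j - x j| < r})⁻¹ *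
      ∫⁻ y in {y : Fin d → ℝ | ∀ j, |y j - x j| < r}, ENNReal.ofReal |f y| ∂volume

theorem lintegral_pi_prod_eq_prod_lintegral {n : ℕ} (μ : Fin n → Measure ℝ)
    [∀ i, SigmaFinite (μ i)] (f : Fin n → ℝ → ℝ≥0∞) (hf : ∀ i, Measurable (f i)) :
    ∫⁻ z, ∏ i, f i (z i) ∂(Measure.pi μ) = ∏ i, ∫⁻ t, f i t ∂(μ i) := by
  induction n with
  | zero => simp
  | succ n ih =>
    have hmp := (measurePreserving_piFinSuccAbove μ 0).symm
    rw [← hmp.lintegral_comp_emb (MeasurableEquiv.measurableEmbedding _)]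
    simp only [Fin.prod_univ_succ]
    rw [← ih (fun i => μ i.succ) (fun i => f i.succ) fun i => hf _]
    have hm : Measurable fun z : Fin n → ℝ => ∏ i, f i.succ (z i) :=
      Finset.measurable_prod _ fun i _ => (hf _).comp (measurable_pi_apply i)
    rw [← lintegral_prod_mul (hf 0).aemeasurable hm.aemeasurable]
    simp [MeasurableEquiv.piFinSuccAbove, Fin.insertNthEquiv]

theorem setLIntegral_univ_pi_prod {n : ℕ} (s : Fin n → Set ℝ) (f : Fin n → ℝ → ℝ≥0∞)
    (hf : ∀ i, Measurable (f i)) :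
    ∫⁻ z in Set.univ.pi s, ∏ i, f i (z i) = ∏ i, ∫⁻ t in s i, f i t := by
  rw [volume_pi, Measure.restrict_pi_pi]
  exact lintegral_pi_prod_eq_prod_lintegral _ f hf

theorem measurable_nuDens (κ x y : ℝ) : Measurable (nuDens κ x y) := by
  unfold nuDens
  have h1 : Measurable fun z : ℝ => sigma3 x y z := by
    unfold sigma3
    split_ifs <;> fun_prop
  have h2 : Measurable fun z : ℝ => Kker κ |x| |y| |z| := by
    unfold Kker triArea
    refine Measurable.ite ?_ (by fun_prop) (by fun_prop)
    exact (measurableSet_le measurable_const measurable_abs).inter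
      (measurableSet_le measurable_abs measurable_const)
  fun_prop

theorem measurableSet_abs_lt (r : ℝ) : MeasurableSet {t : ℝ | |t| < r} :=
  measurableSet_lt measurable_abs measurable_const

theorem Mconst_pos {κ : ℝ} (hκ : 0 < κ) : 0 < Mconst κ :=
  div_pos (Gamma_pos_of_pos (by linarith))
    (mul_pos (Gamma_pos_of_pos hκ) (Gamma_pos_of_pos (by norm_num)))

/-- After substituting `u = 1 - cos θ`, where `θ` is the angle opposite to `z`, the kernel becomes
a Gegenbauer weight. -/
theorem Kker_mul_rpow {κ a b z : ℝ} (hκ : 0 < κ) (ha : 0 < a) (hb : 0 < b)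
    (hz : 0 ≤ z) (h1 : |a - b| ≤ z) (h2 : z ≤ a + b) :
    Kker κ a b z * z ^ (2 * κ) = z / (a * b) *
      (Mconst κ * ((z ^ 2 - (a - b) ^ 2) / (2 * a * b) *
        (2 - (z ^ 2 - (a - b) ^ 2) / (2 * a * b))) ^ (κ - 1)) := by
  rcases hz.eq_or_lt with rfl | hz
  · simp [zero_rpow (by positivity : 2 * κ ≠ 0)]
  have hab : 0 < a * b := mul_pos ha hb
  have hu0 : 0 ≤ (z ^ 2 - (a - b) ^ 2) / (2 * a * b) := by
    have := sq_le_sq.2 (h1.trans (le_abs_self z))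
    apply div_nonneg <;> nlinarith
  have hu2 : (z ^ 2 - (a - b) ^ 2) / (2 * a * b) ≤ 2 := by
    rw [div_le_iff₀ (by positivity)]
    nlinarith
  have hz2 : z ^ 2 = (a - b) ^ 2 + (z ^ 2 - (a - b) ^ 2) / (2 * a * b) * (2 * a * b) := by
    field_simp
    ring
  set u := (z ^ 2 - (a - b) ^ 2) / (2 * a * b) with hu
  have hw : 0 ≤ u * (2 - u) := mul_nonneg hu0 (by linarith)
  have harea : triArea a b z = (a * b / 2) * √(u * (2 - u)) := by
    unfold triArea
    rw [← Real.sqrt_sq (by positivity : 0 ≤ a * b / 2), ← Real.sqrt_mul (by positivity)]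
    congr 1
    have : (a + b + z) / 2 * ((a + b + z) / 2 - a) * ((a + b + z) / 2 - b) *
        ((a + b + z) / 2 - z) = ((a + b) ^ 2 - z ^ 2) * (z ^ 2 - (a - b) ^ 2) / 16 := by ring
    rw [this, hz2]
    ring
  have hsq : √(u * (2 - u)) ^ (2 * κ - 2) = (u * (2 - u)) ^ (κ - 1) := by
    rw [Real.sqrt_eq_rpow, ← rpow_mul hw]
    congr 1
    ring
  have h4 : (2 : ℝ) ^ (2 * κ - 2) * (a * b / 2) ^ (2 * κ - 2) = (a * b) ^ (2 * κ - 2) := by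
    rw [← mul_rpow (by norm_num) (by positivity)]
    congr 1
    ring
  have h5 : (a * b) ^ (2 * κ - 2) * (a * b) ^ (1 - 2 * κ) = (a * b)⁻¹ := by
    rw [← rpow_add hab, ← rpow_neg_one]
    congr 1
    ring
  have h6 : z ^ (1 - 2 * κ) * z ^ (2 * κ) = z := by
    rw [← rpow_add hz]
    simp
  unfold Kker
  rw [if_pos ⟨h1, h2⟩, harea, mul_rpow (by positivity) (Real.sqrt_nonneg _), hsq,
    mul_rpow hab.le hz.le]
  calc _ = ((2 : ℝ) ^ (2 * κ - 2) * (a * b / 2) ^ (2 * κ - 2)) * (a * b) ^ (1 - 2 * κ) *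
        (z ^ (1 - 2 * κ) * z ^ (2 * κ)) * (Mconst κ * (u * (2 - u)) ^ (κ - 1)) := by ring
    _ = _ := by rw [h4, h5, h6]; ring

theorem Kker_nonneg {κ a b z : ℝ} (hκ : 0 < κ) (ha : 0 ≤ a) (hb : 0 ≤ b) (hz : 0 ≤ z) :
    0 ≤ Kker κ a b z := by
  have := (Mconst_pos hκ).le
  unfold Kker triArea
  split_ifs <;> positivity

theorem abs_sigma3_le_one {x y z : ℝ} (h1 : |(|x| - |y|)| ≤ |z|) (h2 : |z| ≤ |x| + |y|) :
    |sigma3 x y z| ≤ 1 := by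
  unfold sigma3
  split_ifs with h
  · have hx := abs_pos.2 h.1
    have hy := abs_pos.2 h.2
    rw [abs_div, div_le_one (by simp [h.1, h.2]), abs_mul, abs_mul, abs_two, abs_le]
    have h3 := sq_le_sq' (by linarith [abs_nonneg z]) h2
    have h4 := sq_le_sq.2 (h1.trans (le_abs_self _))
    constructor <;> nlinarith [sq_abs x, sq_abs y, sq_abs z]
  · simp

theorem nuDens_eq_zero {κ x y z : ℝ} (h : ¬(|(|x| - |y|)| ≤ |z| ∧ |z| ≤ |x| + |y|)) :
    nuDens κ x y z = 0 := by
  simp [nuDens, Kker, h]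

theorem nuDens_le {κ x y z : ℝ} (hκ : 0 < κ) (hx : x ≠ 0) (hy : y ≠ 0)
    (h1 : |(|x| - |y|)| ≤ |z|) (h2 : |z| ≤ |x| + |y|) :
    nuDens κ x y z ≤ ENNReal.ofReal |z / (|x| * |y|)| *
      ENNReal.ofReal (Mconst κ * ((z ^ 2 - (|x| - |y|) ^ 2) / (2 * |x| * |y|) *
        (2 - (z ^ 2 - (|x| - |y|) ^ 2) / (2 * |x| * |y|))) ^ (κ - 1)) := by
  rw [← ENNReal.ofReal_mul (abs_nonneg _)]
  have key := Kker_mul_rpow hκ (abs_pos.2 hx) (abs_pos.2 hy) (abs_nonneg z) h1 h2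
  rw [sq_abs] at key
  rw [abs_div, abs_mul, abs_abs, abs_abs, ← key]
  apply ENNReal.ofReal_le_ofReal
  have hK : 0 ≤ Kker κ |x| |y| |z| * |z| ^ (2 * κ) :=
    mul_nonneg (Kker_nonneg hκ (abs_nonneg _) (abs_nonneg _) (abs_nonneg _)) (by positivity)
  nlinarith [abs_le.1 (abs_sigma3_le_one h1 h2)]

theorem setLIntegral_nuDens_le {κ x y r s : ℝ} (hκ : 0 < κ) (hx : x ≠ 0) (hy : y ≠ 0)
    (hs : ∀ z, |z| < r → |z| ≤ |x| + |y| → (z ^ 2 - (|x| - |y|) ^ 2) / (2 * |x| * |y|) ≤ s) :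
    ∫⁻ z in {z | |z| < r}, nuDens κ x y z ≤
      2 * ∫⁻ u in Icc 0 (min 2 s), ENNReal.ofReal (Mconst κ * (u * (2 - u)) ^ (κ - 1)) := by
  have hx' := abs_pos.2 hx
  have hy' := abs_pos.2 hy
  set g : ℝ → ℝ := fun z => (z ^ 2 - (|x| - |y|) ^ 2) / (2 * |x| * |y|) with hg
  set F : ℝ → ℝ≥0∞ := fun u => ENNReal.ofReal (Mconst κ * (u * (2 - u)) ^ (κ - 1))
  have hhalf : ∀ S : Set ℝ, MeasurableSet S → InjOn g S →
      (∀ z ∈ S, |z| < r ∧ |(|x| - |y|)| ≤ |z| ∧ |z| ≤ |x| + |y|) →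
      ∫⁻ z in S, nuDens κ x y z ≤ ∫⁻ u in Icc 0 (min 2 s), F u := by
    intro S hS hinj hST
    calc ∫⁻ z in S, nuDens κ x y z
        ≤ ∫⁻ z in S, ENNReal.ofReal |z / (|x| * |y|)| * F (g z) :=
          setLIntegral_mono' hS fun z hz => nuDens_le hκ hx hy (hST z hz).2.1 (hST z hz).2.2
      _ = ∫⁻ u in g '' S, F u := by
          rw [lintegral_image_eq_lintegral_abs_deriv_mul hS (fun z _ => ?_) hinj F]
          have := (((hasDerivAt_pow 2 z).sub_const ((|x| - |y|) ^ 2)).div_const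
            (2 * |x| * |y|)).hasDerivWithinAt (s := S)
          convert! this using 1
          field_simp
          simp [mul_comm]
      _ ≤ _ := by
          apply lintegral_mono_set
          rintro _ ⟨z, hz, rfl⟩
          obtain ⟨h0, h1, h2⟩ := hST z hz
          have h3 := sq_le_sq' (by linarith [abs_nonneg z]) h2
          have h4 := sq_le_sq.2 (h1.trans (le_abs_self _))
          rw [sq_abs] at h3 h4
          refine ⟨div_nonneg (by linarith) (by positivity), le_min ?_ (hs z h0 h2)⟩
          rw [hg, div_le_iff₀ (by positivity)]
          nlinarith
  set T : Set ℝ := {z | |z| < r ∧ |(|x| - |y|)| ≤ |z| ∧ |z| ≤ |x| + |y|}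
  have hTm : MeasurableSet T :=
    (measurableSet_abs_lt r).inter
      ((measurableSet_le measurable_const measurable_abs).inter
        (measurableSet_le measurable_abs measurable_const))
  have hgsq : ∀ z w, g z = g w → z ^ 2 = w ^ 2 := by
    intro z w h
    rw [hg] at h
    have := (div_left_inj' (by positivity : 2 * |x| * |y| ≠ 0)).1 h
    linarith
  have hzero : ∫⁻ z in {z | |z| < r}, nuDens κ x y z ≤ ∫⁻ z in T, nuDens κ x y z := by
    rw [← lintegral_indicator (measurableSet_abs_lt r),
      ← lintegral_indicator hTm]
    refine lintegral_mono fun z => ?_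
    by_cases hz : |z| < r
    · by_cases h : |(|x| - |y|)| ≤ |z| ∧ |z| ≤ |x| + |y|
      · rw [indicator_of_mem (show z ∈ T from ⟨hz, h⟩)]
        exact indicator_le_self _ _ _
      · simp [indicator, nuDens_eq_zero h]
    · simp [indicator, hz]
  have hsplit : T ⊆ (T ∩ Ici 0) ∪ (T ∩ Iic 0) := fun z hz =>
    (le_total 0 z).imp (fun h => ⟨hz, h⟩) fun h => ⟨hz, h⟩
  calc _ ≤ ∫⁻ z in T, nuDens κ x y z := hzero
    _ ≤ ∫⁻ z in (T ∩ Ici 0) ∪ (T ∩ Iic 0), nuDens κ x y z := lintegral_mono_set hsplit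
    _ ≤ _ := lintegral_union_le _ _ _
    _ ≤ _ := by
      rw [two_mul]
      refine add_le_add (hhalf _ (hTm.inter measurableSet_Ici) ?_ fun z hz => hz.1)
        (hhalf _ (hTm.inter measurableSet_Iic) ?_ fun z hz => hz.1)
      · intro z hz w hw h
        exact (sq_eq_sq₀ hz.2 hw.2).1 (hgsq z w h)
      · intro z hz w hw h
        have h1 : z ≤ 0 := hz.2
        have h2 : w ≤ 0 := hw.2
        linarith [abs_of_nonpos h1, abs_of_nonpos h2,
          (sq_eq_sq_iff_abs_eq_abs z w).1 (hgsq z w h)]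

theorem mul_two_sub_rpow_le {κ u : ℝ} (hκ : 0 < κ) (h0 : 0 ≤ u) (h1 : u ≤ 1) :
    (u * (2 - u)) ^ (κ - 1) ≤ 2 ^ κ * u ^ (κ - 1) := by
  rw [mul_rpow h0 (by linarith), mul_comm]
  refine mul_le_mul_of_nonneg_right ?_ (by positivity)
  calc (2 - u) ^ (κ - 1) ≤ (2 - u) ^ κ := rpow_le_rpow_of_exponent_le (by linarith) (by linarith)
    _ ≤ 2 ^ κ := rpow_le_rpow (by linarith) (by linarith) hκ.le

theorem setLIntegral_rpow_sub_one {κ s : ℝ} (hκ : 0 < κ) (hs : 0 ≤ s) :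
    ∫⁻ u in Icc 0 s, ENNReal.ofReal (u ^ (κ - 1)) = ENNReal.ofReal (s ^ κ / κ) := by
  have hint : IntervalIntegrable (fun u : ℝ => u ^ (κ - 1)) volume 0 s :=
    intervalIntegral.intervalIntegrable_rpow' (by linarith)
  rw [← restrict_Ioc_eq_restrict_Icc, ← ofReal_integral_eq_lintegral_ofReal
    ((intervalIntegrable_iff_integrableOn_Ioc_of_le hs).1 hint)
    ((ae_restrict_iff' measurableSet_Ioc).2 (.of_forall fun u hu => rpow_nonneg hu.1.le _)),
    ← intervalIntegral.integral_of_le hs, integral_rpow (.inl (by linarith))]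
  simp [zero_rpow hκ.ne']

theorem setLIntegral_mul_two_sub_rpow_le {κ s : ℝ} (hκ : 0 < κ) (hs : 0 ≤ s) (hs1 : s ≤ 1) :
    ∫⁻ u in Icc 0 s, ENNReal.ofReal ((u * (2 - u)) ^ (κ - 1)) ≤
      ENNReal.ofReal (2 ^ κ / κ * s ^ κ) := by
  calc _ ≤ ∫⁻ u in Icc 0 s, ENNReal.ofReal (2 ^ κ) * ENNReal.ofReal (u ^ (κ - 1)) := by
        refine setLIntegral_mono' measurableSet_Icc fun u hu => ?_
        rw [← ENNReal.ofReal_mul (by positivity)]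
        exact ENNReal.ofReal_le_ofReal (mul_two_sub_rpow_le hκ hu.1 (hu.2.trans hs1))
    _ = _ := by
        rw [lintegral_const_mul' _ _ ENNReal.ofReal_ne_top, setLIntegral_rpow_sub_one hκ hs,
          ← ENNReal.ofReal_mul (by positivity)]
        congr 1
        ring

theorem setLIntegral_Icc_zero_two_le {κ : ℝ} (hκ : 0 < κ) :
    ∫⁻ u in Icc 0 2, ENNReal.ofReal ((u * (2 - u)) ^ (κ - 1)) ≤
      ENNReal.ofReal (2 * (2 ^ κ / κ)) := by
  have hG := setLIntegral_mul_two_sub_rpow_le hκ zero_le_one le_rfl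
  rw [one_rpow, mul_one] at hG
  have hrefl : ∫⁻ u in Icc 1 2, ENNReal.ofReal ((u * (2 - u)) ^ (κ - 1)) =
      ∫⁻ u in Icc 0 1, ENNReal.ofReal ((u * (2 - u)) ^ (κ - 1)) := by
    rw [← (Measure.measurePreserving_sub_left volume (2 : ℝ)).setLIntegral_comp_preimage
      (measurableSet_Icc) (by fun_prop)]
    have : (fun u : ℝ => 2 - u) ⁻¹' Icc 1 2 = Icc 0 1 := by
      ext u
      simp only [mem_preimage, mem_Icc]
      constructor <;> rintro ⟨h1, h2⟩ <;> constructor <;> linarith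
    rw [this]
    congr 1
    ext u
    congr 2
    ring
  rw [← Icc_union_Icc_eq_Icc (zero_le_one' ℝ) one_le_two]
  refine (lintegral_union_le _ _ _).trans ?_
  rw [hrefl, two_mul, ENNReal.ofReal_add (by positivity) (by positivity)]
  exact add_le_add hG hG

theorem setLIntegral_Icc_min_two_le {κ s : ℝ} (hκ : 0 < κ) (hs : 0 < s) :
    ∫⁻ u in Icc 0 (min 2 s), ENNReal.ofReal ((u * (2 - u)) ^ (κ - 1)) ≤
      ENNReal.ofReal (2 * (2 ^ κ / κ) * s ^ κ) := by
  have h0 : 0 < 2 ^ κ / κ := by positivity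
  rcases le_total s 1 with h | h
  · rw [min_eq_right (by linarith)]
    refine (setLIntegral_mul_two_sub_rpow_le hκ hs.le h).trans (ENNReal.ofReal_le_ofReal ?_)
    have := rpow_nonneg hs.le κ
    nlinarith [mul_nonneg h0.le this]
  · refine (lintegral_mono_set (Icc_subset_Icc_right (min_le_left _ _))).trans
      ((setLIntegral_Icc_zero_two_le hκ).trans (ENNReal.ofReal_le_ofReal ?_))
    have := one_le_rpow h hκ.le
    nlinarith

theorem setLIntegral_nuDens_le_rpow {κ x y r s : ℝ} (hκ : 0 < κ) (hx : x ≠ 0) (hy : y ≠ 0)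
    (hs0 : 0 < s)
    (hs : ∀ z, |z| < r → |z| ≤ |x| + |y| → (z ^ 2 - (|x| - |y|) ^ 2) / (2 * |x| * |y|) ≤ s) :
    ∫⁻ z in {z | |z| < r}, nuDens κ x y z ≤
      ENNReal.ofReal (4 * Mconst κ * (2 ^ κ / κ) * s ^ κ) := by
  refine (setLIntegral_nuDens_le hκ hx hy hs).trans ?_
  have hM := (Mconst_pos hκ).le
  simp_rw [ENNReal.ofReal_mul hM]
  rw [lintegral_const_mul' _ _ ENNReal.ofReal_ne_top]
  refine (mul_le_mul_right (mul_le_mul_right (setLIntegral_Icc_min_two_le hκ hs0) _) _).trans ?_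
  rw [← ENNReal.ofReal_mul hM, ← ENNReal.ofReal_ofNat 2, ← ENNReal.ofReal_mul (by norm_num)]
  apply le_of_eq
  congr 1
  ring

theorem setLIntegral_nuDens_eq_zero {κ x y r : ℝ} (h : r ≤ |(|x| - |y|)|) :
    ∫⁻ z in {z | |z| < r}, nuDens κ x y z = 0 := by
  rw [setLIntegral_congr_fun (g := fun _ => 0)
    (measurableSet_abs_lt r) fun z (hz : |z| < r) =>
      nuDens_eq_zero fun h' => absurd h'.1 (by linarith), lintegral_zero]

theorem setLIntegral_nuDens_eq_zero_of_notMem {κ x y r : ℝ} (h : |y| ∉ Iset x r) :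
    ∫⁻ z in {z | |z| < r}, nuDens κ x y z = 0 := by
  apply setLIntegral_nuDens_eq_zero
  by_contra! h'
  rw [abs_lt] at h'
  exact h ⟨max_le (abs_nonneg y) (by linarith), by linarith⟩

theorem setLIntegral_nuDens_le_ratio {κ x y r : ℝ} (hκ : 0 < κ) (hx : x ≠ 0) (hy : y ≠ 0)
    (hr : 0 < r) :
    ∫⁻ z in {z | |z| < r}, nuDens κ x y z ≤
      ENNReal.ofReal (4 * Mconst κ * (2 ^ κ / κ) * 18 ^ κ * (r / (|x| + r)) ^ (2 * κ)) := by
  have hx' := abs_pos.2 hx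
  have hy' := abs_pos.2 hy
  have hM := Mconst_pos hκ
  have hq : (r / (|x| + r)) ^ (2 * κ) = ((r / (|x| + r)) ^ 2) ^ κ := by
    rw [← rpow_natCast, ← rpow_mul (by positivity)]
    norm_num
  rw [mul_assoc (4 * Mconst κ * (2 ^ κ / κ)), hq, ← mul_rpow (by norm_num) (by positivity)]
  rcases le_or_gt r |(|x| - |y|)| with h | h
  · rw [setLIntegral_nuDens_eq_zero h]
    exact zero_le
  refine setLIntegral_nuDens_le_rpow hκ hx hy (by positivity) fun z hz hz2 => ?_
  rw [div_pow, mul_div_assoc', div_le_div_iff₀ (by positivity) (by positivity)]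
  have hzr : z ^ 2 ≤ r ^ 2 := sq_le_sq.2 (hz.le.trans (le_abs_self r))
  have hz3 : z ^ 2 ≤ (|x| + |y|) ^ 2 := sq_le_sq.2 (hz2.trans (le_abs_self _))
  rcases le_total |x| (2 * r) with hxr | hxr
  · have h1 : z ^ 2 - (|x| - |y|) ^ 2 ≤ 4 * (|x| * |y|) := by linarith
    have h2 : (|x| + r) ^ 2 ≤ 9 * r ^ 2 := by nlinarith
    calc _ ≤ 4 * (|x| * |y|) * (|x| + r) ^ 2 := by gcongr
      _ ≤ 4 * (|x| * |y|) * (9 * r ^ 2) := by gcongr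
      _ = _ := by ring
  · have h1 : z ^ 2 - (|x| - |y|) ^ 2 ≤ r ^ 2 := by nlinarith [sq_nonneg (|x| - |y|)]
    have h2 : (|x| + r) ^ 2 ≤ 9 / 4 * |x| ^ 2 := by nlinarith
    have h3 : |x| ≤ 2 * |y| := by linarith [(abs_lt.1 h).2]
    calc _ ≤ r ^ 2 * (|x| + r) ^ 2 := by gcongr
      _ ≤ r ^ 2 * (9 / 4 * |x| ^ 2) := by gcongr
      _ ≤ r ^ 2 * (9 / 4 * (|x| * (2 * |y|))) := by rw [sq |x|]; gcongr
      _ ≤ _ := by nlinarith [mul_pos hx' hy', mul_pos (mul_pos hx' hy') (sq_pos_of_pos hr)]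

theorem setLIntegral_Iset_le {κ x r : ℝ} (hκ : 0 < κ) (hr : 0 < r) :
    ∫⁻ z in Iset x r, ENNReal.ofReal (|z| ^ (2 * κ)) ≤
      ENNReal.ofReal (2 * r * (|x| + r) ^ (2 * κ)) := by
  calc _ ≤ ∫⁻ z in Iset x r, ENNReal.ofReal ((|x| + r) ^ (2 * κ)) := by
        refine setLIntegral_mono' measurableSet_Ico fun z hz => ENNReal.ofReal_le_ofReal ?_
        refine rpow_le_rpow (abs_nonneg _) ?_ (by positivity)
        rw [abs_of_nonneg ((le_max_left _ _).trans hz.1)]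
        exact hz.2.le
    _ ≤ _ := by
        rw [setLIntegral_const, Iset, Real.volume_Ico, ← ENNReal.ofReal_mul (by positivity),
          mul_comm]
        apply ENNReal.ofReal_le_ofReal
        gcongr
        linarith [le_max_right 0 (|x| - r)]

theorem le_setLIntegral_abs_lt {κ r : ℝ} (hκ : 0 < κ) (hr : 0 < r) :
    ENNReal.ofReal (r / 2 * (r / 2) ^ (2 * κ)) ≤
      ∫⁻ z in {z | |z| < r}, ENNReal.ofReal (|z| ^ (2 * κ)) := by
  have hsub : Ioo (r / 2) r ⊆ {z | |z| < r} := fun z hz => by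
    simpa [abs_of_pos ((half_pos hr).trans hz.1)] using hz.2
  refine le_trans ?_ (lintegral_mono_set hsub)
  calc _ = ∫⁻ z in Ioo (r / 2) r, ENNReal.ofReal ((r / 2) ^ (2 * κ)) := by
        rw [setLIntegral_const, Real.volume_Ioo, ← ENNReal.ofReal_mul (by positivity), mul_comm]
        congr 2
        ring
    _ ≤ _ := setLIntegral_mono' measurableSet_Ioo fun z hz =>
        ENNReal.ofReal_le_ofReal (rpow_le_rpow (by positivity) (hz.1.le.trans (le_abs_self z))
          (by positivity))

theorem setLIntegral_abs_lt_ne_top {κ r : ℝ} (hκ : 0 < κ) :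
    ∫⁻ z in {z | |z| < r}, ENNReal.ofReal (|z| ^ (2 * κ)) ≠ ∞ := by
  have hball : {z : ℝ | |z| < r} = Ioo (-r) r := by
    ext z
    simp [abs_lt]
  refine ne_top_of_le_ne_top ?_ (setLIntegral_mono' (g := fun _ => ENNReal.ofReal (r ^ (2 * κ)))
    (measurableSet_abs_lt r) fun z (hz : |z| < r) =>
      ENNReal.ofReal_le_ofReal (rpow_le_rpow (abs_nonneg _) hz.le (by positivity)))
  rw [setLIntegral_const, hball, Real.volume_Ioo]
  exact ENNReal.mul_ne_top ENNReal.ofReal_ne_top ENNReal.ofReal_ne_top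

theorem exists_setLIntegral_nuDens_mul_le {κ : ℝ} (hκ : 0 < κ) :
    ∃ C : ℝ, 0 < C ∧ ∀ x y r : ℝ, x ≠ 0 → y ≠ 0 → 0 < r →
      (∫⁻ z in {z | |z| < r}, nuDens κ x y z) *
          ∫⁻ z in Iset x r, ENNReal.ofReal (|z| ^ (2 * κ)) ≤
        ENNReal.ofReal C * ∫⁻ z in {z | |z| < r}, ENNReal.ofReal (|z| ^ (2 * κ)) := by
  have hM := Mconst_pos hκ
  refine ⟨4 * Mconst κ * (2 ^ κ / κ) * 18 ^ κ * (4 * 2 ^ (2 * κ)), by positivity,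
    fun x y r hx hy hr => ?_⟩
  refine (mul_le_mul' (setLIntegral_nuDens_le_ratio hκ hx hy hr)
    (setLIntegral_Iset_le hκ hr)).trans
    (le_trans ?_ (mul_le_mul_right (le_setLIntegral_abs_lt hκ hr) _))
  rw [← ENNReal.ofReal_mul (by positivity), ← ENNReal.ofReal_mul (by positivity)]
  apply le_of_eq
  congr 1
  have hxr : 0 < |x| + r := by positivity
  rw [div_rpow hr.le hxr.le, div_rpow hr.le zero_le_two]
  have := (rpow_pos_of_pos hxr (2 * κ)).ne'
  field_simp
  ring

theorem measurableSet_cubeQ (d : ℕ) (r : ℝ) : MeasurableSet (cubeQ d r) := by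
  unfold cubeQ
  measurability

theorem cubeQ_eq_pi (d : ℕ) (r : ℝ) :
    cubeQ d r = Set.univ.pi fun _ => {t : ℝ | |t| < r} := by
  ext z
  simp [cubeQ]

theorem measurableSet_regSet (d : ℕ) : MeasurableSet (regSet d) := by
  unfold regSet
  measurability

theorem measurableSet_Rset (d : ℕ) (x : Fin d → ℝ) (r : ℝ) : MeasurableSet (Rset d x r) :=
  MeasurableSet.univ_pi fun _ => measurableSet_Ico

theorem muK_univ_pi {d : ℕ} (κ : Fin d → ℝ) (s : Fin d → Set ℝ)
    (hs : ∀ j, MeasurableSet (s j)) :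
    muK d κ (Set.univ.pi s) = ∏ j, ∫⁻ t in s j, ENNReal.ofReal (|t| ^ (2 * κ j)) := by
  rw [muK, withDensity_apply _ (MeasurableSet.univ_pi hs)]
  simp_rw [ENNReal.ofReal_prod_of_nonneg fun j (_ : j ∈ Finset.univ) =>
    rpow_nonneg (abs_nonneg _) _]
  exact setLIntegral_univ_pi_prod s (fun j t => ENNReal.ofReal (|t| ^ (2 * κ j)))
    fun j => by fun_prop

theorem upsilon_cubeQ (d : ℕ) (κ x y : Fin d → ℝ) (r : ℝ) :
    upsilon d κ x y (cubeQ d r) = ∏ j, ∫⁻ t in {t | |t| < r}, nuDens (κ j) (x j) (y j) t := by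
  rw [upsilon, withDensity_apply _ (measurableSet_cubeQ d r), cubeQ_eq_pi]
  exact setLIntegral_univ_pi_prod _ _ fun j => measurable_nuDens _ _ _

theorem muK_cubeQ_ne_zero {d : ℕ} {κ : Fin d → ℝ} (hκ : ∀ j, 0 < κ j) {r : ℝ} (hr : 0 < r) :
    muK d κ (cubeQ d r) ≠ 0 := by
  rw [cubeQ_eq_pi, muK_univ_pi κ _ fun _ => measurableSet_abs_lt r]
  refine Finset.prod_ne_zero_iff.2 fun j _ => ne_of_gt ?_
  exact lt_of_lt_of_le (ENNReal.ofReal_pos.2 (by positivity)) (le_setLIntegral_abs_lt (hκ j) hr)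

theorem muK_cubeQ_ne_top {d : ℕ} {κ : Fin d → ℝ} (hκ : ∀ j, 0 < κ j) (r : ℝ) :
    muK d κ (cubeQ d r) ≠ ∞ := by
  rw [cubeQ_eq_pi, muK_univ_pi κ _ fun _ => measurableSet_abs_lt r]
  exact ENNReal.prod_ne_top fun j _ => setLIntegral_abs_lt_ne_top (hκ j)

theorem upsilon_neg_eq_zero {d : ℕ} {κ x y : Fin d → ℝ} {r : ℝ}
    (h : (fun j => |y j|) ∉ Rset d x r) : upsilon d κ x (-y) (cubeQ d r) = 0 := by
  simp only [Rset, Set.mem_univ_pi, not_forall] at h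
  obtain ⟨j, hj⟩ := h
  rw [upsilon_cubeQ]
  refine Finset.prod_eq_zero (Finset.mem_univ j) (setLIntegral_nuDens_eq_zero_of_notMem ?_)
  simpa using hj

theorem exists_upsilon_mul_le {d : ℕ} {κ : Fin d → ℝ} (hκ : ∀ j, 0 < κ j) :
    ∃ C : ℝ, 0 < C ∧ ∀ x ∈ regSet d, ∀ y ∈ regSet d, ∀ r : ℝ, 0 < r →
      upsilon d κ x (-y) (cubeQ d r) * muK d κ (Rset d x r) ≤
        ENNReal.ofReal C * muK d κ (cubeQ d r) := by
  choose C hC0 hC using fun j => exists_setLIntegral_nuDens_mul_le (hκ j)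
  refine ⟨∏ j, C j, Finset.prod_pos fun j _ => hC0 j, fun x hx y hy r hr => ?_⟩
  rw [upsilon_cubeQ, cubeQ_eq_pi, Rset, muK_univ_pi κ (fun j => Iset (x j) r) fun _ => measurableSet_Ico,
    muK_univ_pi κ _ fun _ => measurableSet_abs_lt r,
    ENNReal.ofReal_prod_of_nonneg fun j _ => (hC0 j).le, ← Finset.prod_mul_distrib,
    ← Finset.prod_mul_distrib]
  exact Finset.prod_le_prod' fun j _ => hC j _ _ _ (hx j) (neg_ne_zero.2 (hy j)) hr

theorem enorm_integral_upsilon_le {d : ℕ} {κ : Fin d → ℝ} (hκ : ∀ j, 0 < κ j) {C : ℝ}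
    (hC0 : 0 < C) {x : Fin d → ℝ} {r : ℝ} (hr : 0 < r)
    (hC : ∀ y ∈ regSet d, upsilon d κ x (-y) (cubeQ d r) * muK d κ (Rset d x r) ≤
      ENNReal.ofReal C * muK d κ (cubeQ d r)) {f : (Fin d → ℝ) → ℝ} (hf : Measurable f) :
    ‖∫ y in regSet d, f y * (upsilon d κ x (-y) (cubeQ d r)).toReal ∂(muK d κ)‖ₑ ≤
      ENNReal.ofReal C * muK d κ (cubeQ d r) / muK d κ (Rset d x r) *
        ∫⁻ y in {y | (fun j => |y j|) ∈ Rset d x r}, ENNReal.ofReal |f y| ∂(muK d κ) := by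
  set S : Set (Fin d → ℝ) := {y | (fun j => |y j|) ∈ Rset d x r}
  set B := ENNReal.ofReal C * muK d κ (cubeQ d r) / muK d κ (Rset d x r)
  have hSm : MeasurableSet S := by
    refine measurableSet_preimage (f := fun y : Fin d → ℝ => fun j => |y j|) ?_
      (measurableSet_Rset d x r)
    fun_prop
  have hU : ∀ y ∈ regSet d, upsilon d κ x (-y) (cubeQ d r) ≤ B := fun y hy =>
    (ENNReal.le_div_iff_mul_le
      (.inr (mul_ne_zero (ENNReal.ofReal_pos.2 hC0).ne' (muK_cubeQ_ne_zero hκ hr)))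
      (.inr (ENNReal.mul_ne_top ENNReal.ofReal_ne_top (muK_cubeQ_ne_top hκ r)))).2 (hC y hy)
  calc _ ≤ ∫⁻ y in regSet d, ‖f y * (upsilon d κ x (-y) (cubeQ d r)).toReal‖ₑ ∂(muK d κ) :=
        enorm_integral_le_lintegral_enorm _
    _ ≤ ∫⁻ y in regSet d, S.indicator (fun y => B * ENNReal.ofReal |f y|) y ∂(muK d κ) := by
        refine setLIntegral_mono' (measurableSet_regSet d) fun y hy => ?_
        by_cases hyS : y ∈ S
        · rw [indicator_of_mem hyS, enorm_mul, mul_comm, Real.enorm_eq_ofReal_abs (f y)]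
          refine mul_le_mul_left ?_ _
          rw [Real.enorm_eq_ofReal ENNReal.toReal_nonneg]
          exact ENNReal.ofReal_toReal_le.trans (hU y hy)
        · simp [upsilon_neg_eq_zero hyS]
    _ ≤ ∫⁻ y, S.indicator (fun y => B * ENNReal.ofReal |f y|) y ∂(muK d κ) :=
        setLIntegral_le_lintegral _ _
    _ = _ := by
        rw [lintegral_indicator hSm, lintegral_const_mul _ (by fun_prop)]

/-- The weighted maximal operator `M_κ^R` controls the cube Dunkl maximal operator `M_κ^Q`
on regular points. -/
theorem MQ_le_MR
    (d : ℕ) (hd : 1 ≤ d) (κ : Fin d → ℝ) (hκ : ∀ j, 0 < κ j) :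
    ∃ C : ℝ, 0 < C ∧ ∀ f : (Fin d → ℝ) → ℝ, Measurable f →
      ∀ x ∈ regSet d, MdunklQ d κ f x ≤ ENNReal.ofReal C * MR d κ f x := by
  obtain ⟨C, hC0, hC⟩ := exists_upsilon_mul_le hκ
  have hc : 0 ≤ cKappa d κ := inv_nonneg.2 (integral_nonneg fun _ => (exp_pos _).le)
  refine ⟨cKappa d κ * C + 1, by positivity, fun f hf x hx => iSup₂_le fun r hr => ?_⟩
  have hQ0 := muK_cubeQ_ne_zero hκ hr
  have hQt := muK_cubeQ_ne_top hκ r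
  have hbound := enorm_integral_upsilon_le hκ hC0 hr (fun y hy => hC x hx y hy r hr) hf
  rw [Real.enorm_eq_ofReal_abs] at hbound
  set Q := muK d κ (cubeQ d r)
  set R := muK d κ (Rset d x r)
  set L := ∫⁻ y in {y | (fun j => |y j|) ∈ Rset d x r}, ENNReal.ofReal |f y| ∂(muK d κ)
  have hMR : R⁻¹ * L ≤ MR d κ f x :=
    le_iSup₂ (f := fun (r : ℝ) (_ : 0 < r) => (muK d κ (Rset d x r))⁻¹ *
      ∫⁻ y in {y | (fun j => |y j|) ∈ Rset d x r}, ENNReal.ofReal |f y| ∂(muK d κ)) r hr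
  rw [ENNReal.ofReal_mul (by positivity), ENNReal.ofReal_div_of_pos (ENNReal.toReal_pos hQ0 hQt),
    ENNReal.ofReal_toReal hQt]
  calc _ ≤ ENNReal.ofReal (cKappa d κ) / Q * (ENNReal.ofReal C * Q / R * L) :=
        mul_le_mul_right hbound _
    _ = ENNReal.ofReal (cKappa d κ * C) * (R⁻¹ * L) * (Q * Q⁻¹) := by
        rw [ENNReal.ofReal_mul hc, div_eq_mul_inv, div_eq_mul_inv]
        ring
    _ = ENNReal.ofReal (cKappa d κ * C) * (R⁻¹ * L) := by
        rw [ENNReal.mul_inv_cancel hQ0 hQt, mul_one]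
    _ ≤ _ := mul_le_mul' (ENNReal.ofReal_le_ofReal (by linarith)) hMR
end
end

section
/- Let 1 < r < ∞ and 1 < p < ∞, and let (f_n)_{n≥1} be a sequence of measurable functions on ℝ^d such that (Σ_{n=1}^∞ |f_n(·)|^r)^{1/r} ∈ L^p(ℝ^d; dm). Then ‖(Σ_{n=1}^∞ |M f_n(·)|^r)^{1/r}‖_p ≤ C ‖(Σ_{n=1}^∞ |f_n(·)|^r)^{1/r}‖_p, where C = C(r,p) is independent of (f_n). -/
noncomputable section
open MeasureTheory Set Real
open scoped ENNReal NNReal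

/-- The centered maximal operator over sup-norm balls (open cubes), for functions with values in
`ℝ≥0∞`. -/
def cubeMaximal {d : ℕ} (f : (Fin d → ℝ) → ℝ≥0∞) (x : Fin d → ℝ) : ℝ≥0∞ :=
  ⨆ (r : ℝ) (_ : 0 < r), (volume (Metric.ball x r))⁻¹ * ∫⁻ y in Metric.ball x r, f y

section Cubes

variable {d : ℕ}

lemma volume_cube_ne_zero (x : Fin d → ℝ) {r : ℝ} (hr : 0 < r) :
    volume (Metric.ball x r) ≠ 0 :=
  (Metric.measure_ball_pos volume x hr).ne'

lemma volume_cube_ne_top (x : Fin d → ℝ) (r : ℝ) : volume (Metric.ball x r) ≠ ∞ :=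
  measure_ball_lt_top.ne

lemma volume_cube_mul (x y : Fin d → ℝ) {r c : ℝ} (hr : 0 < r) (hc : 0 < c) :
    volume (Metric.ball y (c * r)) = ENNReal.ofReal c ^ d * volume (Metric.ball x r) := by
  rw [Real.volume_pi_ball _ hr, Real.volume_pi_ball _ (mul_pos hc hr), Fintype.card_fin,
    ← ENNReal.ofReal_pow hc.le, ← ENNReal.ofReal_mul (by positivity)]
  congr 1
  ring

lemma average_le_cubeMaximal (f : (Fin d → ℝ) → ℝ≥0∞) (x : Fin d → ℝ) {r : ℝ} (hr : 0 < r) :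
    (volume (Metric.ball x r))⁻¹ * ∫⁻ y in Metric.ball x r, f y ≤ cubeMaximal f x :=
  le_iSup₂ (f := fun r (_ : 0 < r) =>
    (volume (Metric.ball x r))⁻¹ * ∫⁻ y in Metric.ball x r, f y) r hr

lemma setLIntegral_cube_le (f : (Fin d → ℝ) → ℝ≥0∞) (x : Fin d → ℝ) {r : ℝ} (hr : 0 < r) :
    ∫⁻ y in Metric.ball x r, f y ≤ volume (Metric.ball x r) * cubeMaximal f x := by
  have h := average_le_cubeMaximal f x hr
  rwa [mul_comm, ← div_eq_mul_inv, ENNReal.div_le_iff' (volume_cube_ne_zero x hr)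
    (volume_cube_ne_top x r)] at h

lemma cubeMaximal_mono {f g : (Fin d → ℝ) → ℝ≥0∞} (h : f ≤ᵐ[volume] g) (x : Fin d → ℝ) :
    cubeMaximal f x ≤ cubeMaximal g x :=
  iSup₂_mono fun _ _ => mul_le_mul_right (lintegral_mono_ae (ae_restrict_of_ae h)) _

lemma lowerSemicontinuous_setLIntegral_ball (f : (Fin d → ℝ) → ℝ≥0∞) (r : ℝ) :
    LowerSemicontinuous fun x : Fin d → ℝ => ∫⁻ y in Metric.ball x r, f y := by
  intro x c hc
  obtain ⟨u, u_mono, u_lt, u_lim⟩ := exists_seq_strictMono_tendsto r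
  have hU : Metric.ball x r = ⋃ n, Metric.ball x (u n) := by
    ext y
    simp only [Metric.mem_ball, mem_iUnion]
    refine ⟨fun h => ?_, fun ⟨n, hn⟩ => hn.trans (u_lt n)⟩
    exact (u_lim.eventually (lt_mem_nhds h)).exists
  have hc' : c < ∫⁻ y in Metric.ball x r, f y := hc
  rw [hU, setLIntegral_iUnion_of_directed _
    (directed_of_isDirected_le fun i j hij => Metric.ball_subset_ball (u_mono.monotone hij)),
    lt_iSup_iff] at hc'
  obtain ⟨n, hn⟩ := hc'
  filter_upwards [Metric.ball_mem_nhds x (sub_pos.2 (u_lt n))] with x' hx'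
  refine hn.trans_le (lintegral_mono_set (Metric.ball_subset_ball' ?_))
  rw [Metric.mem_ball, dist_comm] at hx'
  linarith

lemma measurable_cubeMaximal (f : (Fin d → ℝ) → ℝ≥0∞) : Measurable (cubeMaximal f) := by
  refine LowerSemicontinuous.measurable (lowerSemicontinuous_biSup fun r hr => ?_)
  have hv : ∀ x : Fin d → ℝ, volume (Metric.ball x r) = volume (Metric.ball (0 : Fin d → ℝ) r) :=
    fun x => by rw [Real.volume_pi_ball _ hr, Real.volume_pi_ball _ hr]
  simp_rw [hv]
  intro x c hc
  have h0 := volume_cube_ne_zero (0 : Fin d → ℝ) hr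
  have ht := volume_cube_ne_top (0 : Fin d → ℝ) r
  simp only [mul_comm (volume (Metric.ball (0 : Fin d → ℝ) r))⁻¹, ← div_eq_mul_inv, gt_iff_lt] at hc ⊢
  rw [ENNReal.lt_div_iff_mul_lt (.inl h0) (.inl ht)] at hc
  filter_upwards [lowerSemicontinuous_setLIntegral_ball f r x _ hc] with x' hx'
  rwa [ENNReal.lt_div_iff_mul_lt (.inl h0) (.inl ht)]

lemma cubeMaximal_one_le (x : Fin d → ℝ) : cubeMaximal (fun _ => 1) x ≤ 1 := by
  refine iSup₂_le fun r hr => ?_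
  rw [setLIntegral_one, ENNReal.inv_mul_cancel (volume_cube_ne_zero x hr) (volume_cube_ne_top x r)]

lemma cubeMaximal_add_const_le {f g : (Fin d → ℝ) → ℝ≥0∞} {c : ℝ≥0∞} (h : ∀ x, f x ≤ g x + c)
    (x : Fin d → ℝ) : cubeMaximal f x ≤ cubeMaximal g x + c := by
  refine iSup₂_le fun r hr => ?_
  calc (volume (Metric.ball x r))⁻¹ * ∫⁻ y in Metric.ball x r, f y
      ≤ (volume (Metric.ball x r))⁻¹ * ∫⁻ y in Metric.ball x r, (g y + c) :=
        mul_le_mul_right (lintegral_mono fun y => h y) _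
    _ = (volume (Metric.ball x r))⁻¹ * (∫⁻ y in Metric.ball x r, g y) + c := by
        rw [lintegral_add_right _ measurable_const, setLIntegral_const, mul_add, mul_left_comm,
          ENNReal.inv_mul_cancel (volume_cube_ne_zero x hr) (volume_cube_ne_top x r), mul_one]
    _ ≤ cubeMaximal g x + c := by gcongr; exact average_le_cubeMaximal g x hr

/-- The pointwise form of Hölder's inequality for averages. -/
lemma cubeMaximal_mul_rpow_le {f g : (Fin d → ℝ) → ℝ≥0∞} (hf : Measurable f) (hg : Measurable g)
    {a b : ℝ} (ha : 0 ≤ a) (hb : 0 ≤ b) (hab : a + b = 1) (x : Fin d → ℝ) :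
    cubeMaximal (fun y => f y ^ a * g y ^ b) x ≤ cubeMaximal f x ^ a * cubeMaximal g x ^ b := by
  refine iSup₂_le fun r hr => ?_
  set V := (volume (Metric.ball x r))⁻¹
  calc V * ∫⁻ y in Metric.ball x r, f y ^ a * g y ^ b
      ≤ V * ((∫⁻ y in Metric.ball x r, f y) ^ a * (∫⁻ y in Metric.ball x r, g y) ^ b) :=
        mul_le_mul_right (ENNReal.lintegral_mul_norm_pow_le hf.aemeasurable hg.aemeasurable
          ha hb hab) _
    _ = (V * ∫⁻ y in Metric.ball x r, f y) ^ a * (V * ∫⁻ y in Metric.ball x r, g y) ^ b := by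
        rw [ENNReal.mul_rpow_of_nonneg _ _ ha, ENNReal.mul_rpow_of_nonneg _ _ hb,
          mul_mul_mul_comm, ← ENNReal.rpow_add_of_nonneg _ _ ha hb, hab, ENNReal.rpow_one]
    _ ≤ _ := by
        gcongr <;> exact average_le_cubeMaximal _ x hr

/-- The truncated level sets satisfy the weighted weak-type bound of Fefferman and Stein. -/
lemma mul_setLIntegral_truncated_le (f w : (Fin d → ℝ) → ℝ≥0∞) (t : ℝ≥0∞) (R : ℝ) :
    t * ∫⁻ x in {x | ∃ r, 0 < r ∧ r ≤ R ∧
        t * volume (Metric.ball x r) < ∫⁻ y in Metric.ball x r, f y}, w x ≤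
      7 ^ d * ∫⁻ x, f x * cubeMaximal w x := by
  set E := {x : Fin d → ℝ | ∃ r, 0 < r ∧ r ≤ R ∧
        t * volume (Metric.ball x r) < ∫⁻ y in Metric.ball x r, f y}
  have hE : ∀ x : Fin d → ℝ, ∃ r, x ∈ E → 0 < r ∧ r ≤ R ∧
      t * volume (Metric.ball x r) < ∫⁻ y in Metric.ball x r, f y := fun x => by
    by_cases hx : x ∈ E
    · exact ⟨hx.choose, fun _ => hx.choose_spec⟩
    · exact ⟨0, fun h => absurd h hx⟩
  choose ρ hρ using hE
  obtain ⟨u, uE, u_disj, u_cov⟩ :=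
    Vitali.exists_disjoint_subfamily_covering_enlargement_closedBall E id ρ R
      (fun x hx => (hρ x hx).2.1) 5 (by norm_num)
  have disj : u.PairwiseDisjoint fun x => Metric.ball x (ρ x) :=
    u_disj.mono fun x => Metric.ball_subset_closedBall
  have u_count : u.Countable := disj.countable_of_isOpen (fun _ _ => Metric.isOpen_ball)
    fun x hx => Metric.nonempty_ball.2 (hρ x (uE hx)).1
  have hcov : E ⊆ ⋃ b ∈ u, Metric.closedBall b (5 * ρ b) := fun x hx => by
    obtain ⟨b, hb, hsub⟩ := u_cov x hx
    exact mem_biUnion hb (hsub (Metric.mem_closedBall_self (hρ x hx).1.le))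
  have key : ∀ b ∈ u, t * ∫⁻ x in Metric.closedBall b (5 * ρ b), w x ≤
      7 ^ d * ∫⁻ y in Metric.ball b (ρ b), f y * cubeMaximal w y := fun b hb => by
    obtain ⟨hpos, -, hlt⟩ := hρ b (uE hb)
    set W := ∫⁻ x in Metric.closedBall b (5 * ρ b), w x
    have hV0 := volume_cube_ne_zero b hpos
    have hVt := volume_cube_ne_top b (ρ b)
    have hW : ∀ y ∈ Metric.ball b (ρ b),
        W ≤ 7 ^ d * volume (Metric.ball b (ρ b)) * cubeMaximal w y := fun y hy => by
      calc W ≤ ∫⁻ x in Metric.ball y (7 * ρ b), w x := by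
            refine lintegral_mono_set fun z hz => ?_
            rw [Metric.mem_ball] at hy ⊢
            rw [Metric.mem_closedBall] at hz
            have := dist_triangle_right z y b
            linarith
        _ ≤ _ := setLIntegral_cube_le w y (by positivity)
        _ = _ := by rw [volume_cube_mul b y hpos (by norm_num)]; norm_num
    calc t * W = (t * volume (Metric.ball b (ρ b))) * (W / volume (Metric.ball b (ρ b))) := by
          rw [mul_assoc, ENNReal.mul_div_cancel hV0 hVt]
      _ ≤ (∫⁻ y in Metric.ball b (ρ b), f y) * (W / volume (Metric.ball b (ρ b))) := by gcongr
      _ ≤ ∫⁻ y in Metric.ball b (ρ b), f y * (W / volume (Metric.ball b (ρ b))) :=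
          lintegral_mul_const_le _ _
      _ ≤ ∫⁻ y in Metric.ball b (ρ b), 7 ^ d * (f y * cubeMaximal w y) := by
          refine setLIntegral_mono' measurableSet_ball fun y hy => ?_
          rw [mul_left_comm]
          gcongr
          refine ENNReal.div_le_of_le_mul ((hW y hy).trans_eq ?_)
          ring
      _ = _ := lintegral_const_mul' _ _ (by simp)
  calc t * ∫⁻ x in E, w x
      ≤ t * ∑' b : u, ∫⁻ x in Metric.closedBall (b : Fin d → ℝ) (5 * ρ b), w x := by
        gcongr
        have := u_count.to_subtype
        refine (lintegral_mono_set hcov).trans ?_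
        rw [biUnion_eq_iUnion]
        exact lintegral_iUnion_le _ _
    _ ≤ ∑' b : u, 7 ^ d * ∫⁻ y in Metric.ball (b : Fin d → ℝ) (ρ b), f y * cubeMaximal w y := by
        rw [← ENNReal.tsum_mul_left]
        exact ENNReal.tsum_le_tsum fun b => key b b.2
    _ = 7 ^ d * ∫⁻ y in ⋃ b ∈ u, Metric.ball b (ρ b), f y * cubeMaximal w y := by
        rw [ENNReal.tsum_mul_left, lintegral_biUnion u_count (fun _ _ => measurableSet_ball) disj]
    _ ≤ _ := mul_le_mul_right (setLIntegral_le_lintegral _ _) _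

/-- The weighted weak-type `(1, 1)` inequality of Fefferman and Stein. -/
lemma mul_setLIntegral_lt_cubeMaximal_le (f w : (Fin d → ℝ) → ℝ≥0∞) (t : ℝ≥0∞) :
    t * ∫⁻ x in {x | t < cubeMaximal f x}, w x ≤ 7 ^ d * ∫⁻ x, f x * cubeMaximal w x := by
  have hU : {x | t < cubeMaximal f x} = ⋃ n : ℕ, {x | ∃ r, 0 < r ∧ r ≤ (n : ℝ) ∧
      t * volume (Metric.ball x r) < ∫⁻ y in Metric.ball x r, f y} := by
    ext x
    simp only [cubeMaximal, lt_iSup_iff, mem_ofPred_eq, mem_iUnion]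
    constructor
    · rintro ⟨r, hr, h⟩
      obtain ⟨n, hn⟩ := exists_nat_ge r
      refine ⟨n, r, hr, hn, ?_⟩
      rwa [mul_comm _ (lintegral _ _), ← div_eq_mul_inv, ENNReal.lt_div_iff_mul_lt
        (.inl (volume_cube_ne_zero x hr)) (.inl (volume_cube_ne_top x r))] at h
    · rintro ⟨n, r, hr, hn, h⟩
      refine ⟨r, hr, ?_⟩
      rwa [mul_comm _ (lintegral _ _), ← div_eq_mul_inv, ENNReal.lt_div_iff_mul_lt
        (.inl (volume_cube_ne_zero x hr)) (.inl (volume_cube_ne_top x r))]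
  rw [hU, setLIntegral_iUnion_of_directed, ENNReal.mul_iSup]
  · exact iSup_le fun n => mul_setLIntegral_truncated_le f w t n
  · refine directed_of_isDirected_le fun i j hij x hx => ?_
    obtain ⟨r, hr, h, h'⟩ := hx
    exact ⟨r, hr, h.trans (by exact_mod_cast hij), h'⟩

end Cubes

section LayerCake

lemma ENNReal.rpow_eq_lintegral_Ioi (a : ℝ≥0∞) {s : ℝ} (hs : 0 < s) :
    a ^ s = ENNReal.ofReal s *
      ∫⁻ t in Ioi (0 : ℝ), if ENNReal.ofReal t < a then ENNReal.ofReal (t ^ (s - 1)) else 0 := by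
  have hfin : ∀ b : ℝ≥0, (b : ℝ≥0∞) ^ s = ENNReal.ofReal s *
      ∫⁻ t in Ioi (0 : ℝ), if ENNReal.ofReal t < b then ENNReal.ofReal (t ^ (s - 1)) else 0 := by
    intro b
    have h := lintegral_rpow_eq_lintegral_meas_lt_mul (Measure.dirac ())
      (f := fun _ => (b : ℝ)) (ae_of_all _ fun _ => b.2) measurable_const.aemeasurable hs
    rw [lintegral_dirac, ← ENNReal.ofReal_rpow_of_nonneg b.coe_nonneg hs.le,
      ENNReal.ofReal_coe_nnreal] at h
    rw [h]
    congr 1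
    refine setLIntegral_congr_fun measurableSet_Ioi fun t ht => ?_
    have : ENNReal.ofReal t < b ↔ t < b := by
      rw [← ENNReal.ofReal_coe_nnreal]
      exact ENNReal.ofReal_lt_ofReal_iff_of_nonneg (le_of_lt ht)
    by_cases htb : t < b <;> simp [this, htb]
  induction a using ENNReal.recTopCoe with
  | coe b => exact hfin b
  | top =>
    rw [ENNReal.top_rpow_of_pos hs]
    refine (top_le_iff.1 (le_of_forall_lt fun c hc => ?_)).symm
    lift c to ℝ≥0 using hc.ne
    obtain ⟨b, hb⟩ := ENNReal.lt_iff_exists_nnreal_btwn.1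
      (ENNReal.coe_lt_top : ((c ^ (1 / s) : ℝ≥0) : ℝ≥0∞) < ∞)
    have hcb : (c : ℝ≥0∞) < (b : ℝ≥0∞) ^ s := by
      rw [← ENNReal.coe_rpow_of_nonneg _ hs.le, ENNReal.coe_lt_coe]
      rw [ENNReal.coe_lt_coe] at hb
      have := NNReal.rpow_lt_rpow hb.1 hs
      rwa [← NNReal.rpow_mul, one_div_mul_cancel hs.ne', NNReal.rpow_one] at this
    refine hcb.trans_le ((hfin b).trans_le (mul_le_mul_right (lintegral_mono fun t => ?_) _))
    by_cases htb : ENNReal.ofReal t < b <;> simp [htb]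

/-- Weighted layer-cake formula for `ℝ≥0∞`-valued functions. -/
lemma lintegral_rpow_mul_eq_lintegral_setLIntegral {α : Type*} [MeasurableSpace α] (μ : Measure α)
    [SFinite μ] {g w : α → ℝ≥0∞} (hg : Measurable g) (hw : Measurable w) {s : ℝ} (hs : 0 < s) :
    ∫⁻ x, g x ^ s * w x ∂μ = ENNReal.ofReal s * ∫⁻ t in Ioi (0 : ℝ),
      ENNReal.ofReal (t ^ (s - 1)) * ∫⁻ x in {x | ENNReal.ofReal t < g x}, w x ∂μ := by
  have hset : MeasurableSet {q : α × ℝ | ENNReal.ofReal q.2 < g q.1} :=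
    measurableSet_lt (by fun_prop) (by fun_prop)
  have hpow : Measurable fun t : ℝ => ENNReal.ofReal (t ^ (s - 1)) := by fun_prop
  calc ∫⁻ x, g x ^ s * w x ∂μ
      = ∫⁻ x, ENNReal.ofReal s * (∫⁻ t in Ioi (0 : ℝ),
          (if ENNReal.ofReal t < g x then ENNReal.ofReal (t ^ (s - 1)) else 0) * w x) ∂μ := by
        refine lintegral_congr fun x => ?_
        rw [ENNReal.rpow_eq_lintegral_Ioi _ hs, mul_assoc, lintegral_mul_const]
        exact hpow.ite (measurableSet_lt (by fun_prop) measurable_const) measurable_const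
    _ = ENNReal.ofReal s * ∫⁻ x, (∫⁻ t in Ioi (0 : ℝ),
          (if ENNReal.ofReal t < g x then ENNReal.ofReal (t ^ (s - 1)) else 0) * w x) ∂μ :=
        lintegral_const_mul' _ _ ENNReal.ofReal_ne_top
    _ = ENNReal.ofReal s * ∫⁻ t in Ioi (0 : ℝ), ∫⁻ x,
          (if ENNReal.ofReal t < g x then ENNReal.ofReal (t ^ (s - 1)) else 0) * w x ∂μ := by
        rw [lintegral_lintegral_swap]
        exact (((hpow.comp measurable_snd).ite hset measurable_const).mul
          (hw.comp measurable_fst)).aemeasurable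
    _ = _ := by
        congr 1
        refine lintegral_congr fun t => ?_
        rw [← lintegral_indicator (measurableSet_lt measurable_const hg),
          ← lintegral_const_mul' _ _ ENNReal.ofReal_ne_top]
        refine lintegral_congr fun x => ?_
        by_cases h : ENNReal.ofReal t < g x <;> simp [h]

end LayerCake

section StrongType

variable {d : ℕ}

lemma mul_setLIntegral_lt_cubeMaximal_le_setLIntegral {f : (Fin d → ℝ) → ℝ≥0∞} (hf : Measurable f)
    (w : (Fin d → ℝ) → ℝ≥0∞) (t : ℝ≥0∞) :
    t * ∫⁻ x in {x | t < cubeMaximal f x}, w x ≤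
      2 * 7 ^ d * ∫⁻ x in {x | t < 2 * f x}, f x * cubeMaximal w x := by
  have hS : MeasurableSet {x | t < 2 * f x} := measurableSet_lt measurable_const (by fun_prop)
  set g := {x | t < 2 * f x}.indicator f
  have hfg : ∀ x, f x ≤ g x + t / 2 := fun x => by
    by_cases hx : t < 2 * f x
    · simp [g, hx]
    · refine le_add_left ?_
      rw [ENNReal.le_div_iff_mul_le (by simp) (by simp), mul_comm]
      exact not_lt.1 hx
  have hsub : {x | t < cubeMaximal f x} ⊆ {x | t / 2 < cubeMaximal g x} := fun x hx => by
    by_contra hgx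
    have hgx' : cubeMaximal g x ≤ t / 2 := not_lt.1 hgx
    refine absurd (hx.trans_le (cubeMaximal_add_const_le hfg x)) (not_lt.2 ?_)
    calc cubeMaximal g x + t / 2 ≤ t / 2 + t / 2 := by gcongr
      _ = t := ENNReal.add_halves t
  calc t * ∫⁻ x in {x | t < cubeMaximal f x}, w x
      = 2 * (t / 2 * ∫⁻ x in {x | t < cubeMaximal f x}, w x) := by
        rw [← mul_assoc, ENNReal.mul_div_cancel (by simp) (by simp)]
    _ ≤ 2 * (t / 2 * ∫⁻ x in {x | t / 2 < cubeMaximal g x}, w x) := by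
        gcongr
    _ ≤ 2 * (7 ^ d * ∫⁻ x, g x * cubeMaximal w x) := by
        exact mul_le_mul_right (mul_setLIntegral_lt_cubeMaximal_le g w (t / 2)) _
    _ = _ := by
        rw [← mul_assoc, ← lintegral_indicator hS]
        congr 1
        refine lintegral_congr fun x => ?_
        by_cases hx : t < 2 * f x <;> simp [g, hx]

/-- The weighted strong-type inequality of Fefferman and Stein. -/
lemma exists_lintegral_cubeMaximal_rpow_mul_le (d : ℕ) {r : ℝ} (hr : 1 < r) :
    ∃ C : ℝ≥0, ∀ f w : (Fin d → ℝ) → ℝ≥0∞, Measurable f → Measurable w →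
      ∫⁻ x, cubeMaximal f x ^ r * w x ≤ C * ∫⁻ x, f x ^ r * cubeMaximal w x := by
  have hr1 : 0 < r - 1 := sub_pos.2 hr
  have hr0 : 0 < r := one_pos.trans hr
  have hne : ENNReal.ofReal (r - 1) ≠ 0 := by simpa using hr1
  set A : ℝ≥0∞ := ENNReal.ofReal r * ((2 * 7 ^ d) * (2 ^ (r - 1) * (ENNReal.ofReal (r - 1))⁻¹))
  have hA : A ≠ ∞ := by
    refine ENNReal.mul_ne_top ENNReal.ofReal_ne_top (ENNReal.mul_ne_top ?_ (ENNReal.mul_ne_top ?_ ?_))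
    · exact ENNReal.mul_ne_top (by simp) (by simp)
    · exact ENNReal.rpow_ne_top_of_nonneg hr1.le (by simp)
    · simpa using hr
  refine ⟨A.toNNReal, fun f w hf hw => ?_⟩
  rw [ENNReal.coe_toNNReal hA, lintegral_rpow_mul_eq_lintegral_setLIntegral _
    (measurable_cubeMaximal f) hw hr0]
  have hcake := lintegral_rpow_mul_eq_lintegral_setLIntegral volume
    (hf.const_mul 2) (hf.mul (measurable_cubeMaximal w)) hr1
  have hpow : ∀ x, (2 * f x) ^ (r - 1) * (f x * cubeMaximal w x) =
      2 ^ (r - 1) * (f x ^ r * cubeMaximal w x) := fun x => by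
    have : f x ^ r = f x ^ (r - 1) * f x := by
      conv_lhs => rw [← sub_add_cancel r 1,
        ENNReal.rpow_add_of_nonneg _ _ hr1.le zero_le_one, ENNReal.rpow_one]
    rw [ENNReal.mul_rpow_of_nonneg _ _ hr1.le, this]
    ring
  simp only [Pi.mul_apply, hpow] at hcake
  rw [lintegral_const_mul' _ _ (ENNReal.rpow_ne_top_of_nonneg hr1.le (by simp))] at hcake
  set J := ∫⁻ t in Ioi (0 : ℝ), ENNReal.ofReal (t ^ (r - 1 - 1)) *
    ∫⁻ x in {x | ENNReal.ofReal t < 2 * f x}, f x * cubeMaximal w x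
  calc _ ≤ ENNReal.ofReal r * (2 * 7 ^ d * J) := by
        rw [← lintegral_const_mul' _ _ (ENNReal.mul_ne_top (by simp) (by simp))]
        refine mul_le_mul_right (setLIntegral_mono' measurableSet_Ioi fun t ht => ?_) _
        have ht0 : (0 : ℝ) < t := ht
        have : t ^ (r - 1) = t ^ (r - 1 - 1) * t := by
          rw [Real.rpow_sub_one ht0.ne' (r - 1), div_mul_cancel₀ _ ht0.ne']
        rw [this, ENNReal.ofReal_mul (by positivity), mul_assoc, mul_left_comm (2 * 7 ^ d)]
        exact mul_le_mul_right (mul_setLIntegral_lt_cubeMaximal_le_setLIntegral hf w _) _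
    _ = ENNReal.ofReal r * (2 * 7 ^ d * ((ENNReal.ofReal (r - 1))⁻¹ *
          (2 ^ (r - 1) * ∫⁻ x, f x ^ r * cubeMaximal w x))) := by
        rw [hcake, ← mul_assoc (ENNReal.ofReal (r - 1))⁻¹,
          ENNReal.inv_mul_cancel hne ENNReal.ofReal_ne_top, one_mul]
    _ = _ := by simp only [A]; ring

lemma exists_lintegral_cubeMaximal_rpow_le (d : ℕ) {p : ℝ} (hp : 1 < p) :
    ∃ C : ℝ≥0, ∀ f : (Fin d → ℝ) → ℝ≥0∞, Measurable f →
      ∫⁻ x, cubeMaximal f x ^ p ≤ C * ∫⁻ x, f x ^ p := by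
  obtain ⟨C, hC⟩ := exists_lintegral_cubeMaximal_rpow_mul_le d hp
  refine ⟨C, fun f hf => ?_⟩
  have h := hC f (fun _ => 1) hf measurable_const
  simp only [mul_one] at h
  refine h.trans (mul_le_mul_right (lintegral_mono fun x => ?_) _)
  exact mul_le_of_le_one_right' (cubeMaximal_one_le x)

end StrongType

section VectorValued

variable {d : ℕ}

/-- The vector-valued bound for `p ≤ r`, from the pointwise interpolation
`M f ≤ (M φ) ^ (p / r) * (M F) ^ (1 - p / r)` with `φ = (f / F) ^ (r / p) * F`. -/
lemma exists_lintegral_tsum_cubeMaximal_rpow_le_of_le (d : ℕ) {r p : ℝ} (hp : 1 < p)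
    (hpr : p ≤ r) :
    ∃ C : ℝ≥0, ∀ f : ℕ → (Fin d → ℝ) → ℝ≥0∞, (∀ n, Measurable (f n)) →
      ∫⁻ x, (∑' n, f n x ^ r) ^ (p / r) ≠ ∞ →
      ∫⁻ x, (∑' n, cubeMaximal (f n) x ^ r) ^ (p / r) ≤
        C * ∫⁻ x, (∑' n, f n x ^ r) ^ (p / r) := by
  have hp0 : 0 < p := one_pos.trans hp
  have hr0 : 0 < r := hp0.trans_le hpr
  have hθ : 0 ≤ 1 - p / r := sub_nonneg.2 ((div_le_one hr0).2 hpr)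
  have hθ' : 0 < p / r := div_pos hp0 hr0
  obtain ⟨C, hC⟩ := exists_lintegral_cubeMaximal_rpow_le d hp
  refine ⟨C, fun f hf hfin => ?_⟩
  set F : (Fin d → ℝ) → ℝ≥0∞ := fun x => (∑' n, f n x ^ r) ^ (1 / r) with hF
  have hFm : Measurable F :=
    (Measurable.tsum fun n => (hf n).pow_const r).pow_const _
  have hFr : ∀ x, F x ^ r = ∑' n, f n x ^ r := fun x => by
    rw [hF, ← ENNReal.rpow_mul, one_div_mul_cancel hr0.ne', ENNReal.rpow_one]
  have hFp : ∀ x, (∑' n, f n x ^ r) ^ (p / r) = F x ^ p := fun x => by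
    rw [← hFr, ← ENNReal.rpow_mul, mul_div_cancel₀ _ hr0.ne']
  simp only [hFp] at hfin ⊢
  have hFtop : ∀ᵐ x, F x ≠ ∞ := by
    filter_upwards [ae_lt_top (hFm.pow_const p) hfin] with x hx h
    simp [h, hp0] at hx
  have hfF : ∀ n x, f n x ≤ F x := fun n x => by
    rw [← ENNReal.rpow_le_rpow_iff hr0, hFr]
    exact ENNReal.le_tsum n
  set φ : ℕ → (Fin d → ℝ) → ℝ≥0∞ := fun n x => (f n x / F x) ^ (r / p) * F x
  have hφm : ∀ n, Measurable (φ n) := fun n => (((hf n).div hFm).pow_const _).mul hFm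
  have hφp : ∀ n x, φ n x ^ p = (f n x / F x) ^ r * F x ^ p := fun n x => by
    rw [ENNReal.mul_rpow_of_nonneg _ _ hp0.le, ← ENNReal.rpow_mul, div_mul_cancel₀ _ hp0.ne']
  have hφsum : ∀ x, ∑' n, φ n x ^ p ≤ F x ^ p := fun x => by
    simp only [hφp, ENNReal.div_rpow_of_nonneg _ _ hr0.le]
    simp only [div_eq_mul_inv, ENNReal.tsum_mul_right]
    rw [← hFr]
    exact mul_le_of_le_one_left' (ENNReal.mul_inv_le_one _)
  have hfφ : ∀ n, f n ≤ᵐ[volume] fun x => φ n x ^ (p / r) * F x ^ (1 - p / r) := fun n => by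
    filter_upwards [hFtop] with x hx
    by_cases h0 : F x = 0
    · simp [le_zero_iff.1 ((hfF n x).trans_eq h0)]
    · have hFF : F x ^ (p / r) * F x ^ (1 - p / r) = F x := by
        rw [← ENNReal.rpow_add_of_nonneg _ _ hθ'.le hθ, add_sub_cancel, ENNReal.rpow_one]
      have hrp : r / p * (p / r) = 1 := by field_simp
      rw [ENNReal.mul_rpow_of_nonneg _ _ hθ'.le, mul_assoc, hFF, ← ENNReal.rpow_mul, hrp,
        ENNReal.rpow_one, ENNReal.div_mul_cancel h0 hx]
  have hM : ∀ n x, cubeMaximal (f n) x ≤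
      cubeMaximal (φ n) x ^ (p / r) * cubeMaximal F x ^ (1 - p / r) := fun n x =>
    (cubeMaximal_mono (hfφ n) x).trans
      (cubeMaximal_mul_rpow_le (hφm n) hFm hθ'.le hθ (add_sub_cancel _ _) x)
  set H : (Fin d → ℝ) → ℝ≥0∞ := fun x => ∑' n, cubeMaximal (φ n) x ^ p
  have hHm : Measurable H :=
    Measurable.tsum fun n => (measurable_cubeMaximal (φ n)).pow_const p
  have hG : ∀ x, (∑' n, cubeMaximal (f n) x ^ r) ^ (p / r) ≤
      H x ^ (p / r) * (cubeMaximal F x ^ p) ^ (1 - p / r) := fun x => by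
    have h1 : ∑' n, cubeMaximal (f n) x ^ r ≤ H x * cubeMaximal F x ^ ((1 - p / r) * r) := by
      rw [← ENNReal.tsum_mul_right]
      refine ENNReal.tsum_le_tsum fun n => ?_
      calc cubeMaximal (f n) x ^ r
          ≤ (cubeMaximal (φ n) x ^ (p / r) * cubeMaximal F x ^ (1 - p / r)) ^ r := by
            gcongr; exact hM n x
        _ = _ := by
            rw [ENNReal.mul_rpow_of_nonneg _ _ hr0.le, ← ENNReal.rpow_mul, ← ENNReal.rpow_mul,
              div_mul_cancel₀ _ hr0.ne']
    calc _ ≤ (H x * cubeMaximal F x ^ ((1 - p / r) * r)) ^ (p / r) := by gcongr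
      _ = _ := by
        rw [ENNReal.mul_rpow_of_nonneg _ _ hθ'.le, ← ENNReal.rpow_mul, ← ENNReal.rpow_mul]
        congr 2
        field_simp
  have hH : ∫⁻ x, H x ≤ C * ∫⁻ x, F x ^ p := by
    calc ∫⁻ x, H x = ∑' n, ∫⁻ x, cubeMaximal (φ n) x ^ p :=
          lintegral_tsum fun n => ((measurable_cubeMaximal (φ n)).pow_const p).aemeasurable
      _ ≤ ∑' n, C * ∫⁻ x, φ n x ^ p := ENNReal.tsum_le_tsum fun n => hC _ (hφm n)
      _ = C * ∫⁻ x, ∑' n, φ n x ^ p := by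
          rw [ENNReal.tsum_mul_left, lintegral_tsum fun n => ((hφm n).pow_const p).aemeasurable]
      _ ≤ C * ∫⁻ x, F x ^ p := mul_le_mul_right (lintegral_mono hφsum) _
  calc _ ≤ ∫⁻ x, H x ^ (p / r) * (cubeMaximal F x ^ p) ^ (1 - p / r) := lintegral_mono hG
    _ ≤ (∫⁻ x, H x) ^ (p / r) * (∫⁻ x, cubeMaximal F x ^ p) ^ (1 - p / r) :=
        ENNReal.lintegral_mul_norm_pow_le hHm.aemeasurable
          ((measurable_cubeMaximal F).pow_const p).aemeasurable hθ'.le hθ (add_sub_cancel _ _)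
    _ ≤ (C * ∫⁻ x, F x ^ p) ^ (p / r) * (C * ∫⁻ x, F x ^ p) ^ (1 - p / r) := by
        gcongr
        exact hC F hFm
    _ = C * ∫⁻ x, F x ^ p := by
        rw [← ENNReal.rpow_add_of_nonneg _ _ hθ'.le hθ, add_sub_cancel, ENNReal.rpow_one]

lemma ENNReal.le_rpow_mul_of_le_mul_rpow {a b K : ℝ≥0∞} {s : ℝ} (hs : 0 < s) (ha : a ≠ ∞)
    (h : a ≤ K * b ^ (1 / s) * a ^ (1 - 1 / s)) : a ≤ K ^ s * b := by
  rcases eq_or_ne a 0 with rfl | ha0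
  · exact zero_le
  have h1 : a ^ (1 / s) ≤ K * b ^ (1 / s) := by
    have hsplit : a ^ (1 / s) * a ^ (1 - 1 / s) = a := by
      rw [← ENNReal.rpow_add _ _ ha0 ha, add_sub_cancel, ENNReal.rpow_one]
    refine (ENNReal.mul_le_mul_iff_left ?_ ?_).1 (hsplit.trans_le h)
    · simp [ENNReal.rpow_eq_zero_iff, ha0, ha]
    · simp [ENNReal.rpow_eq_top_iff, ha0, ha]
  have h2 := ENNReal.rpow_le_rpow h1 hs.le
  rwa [ENNReal.mul_rpow_of_nonneg _ _ hs.le, ← ENNReal.rpow_mul, ← ENNReal.rpow_mul,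
    one_div_mul_cancel hs.ne', ENNReal.rpow_one, ENNReal.rpow_one] at h2

/-- To bound an integral it suffices to bound the integrals of the integrable functions below. -/
lemma lintegral_le_of_forall_simpleFunc {α : Type*} [MeasurableSpace α] {μ : Measure α}
    [SigmaFinite μ] {g : α → ℝ≥0∞} {L : ℝ≥0∞}
    (h : ∀ φ : SimpleFunc α ℝ≥0, (∀ x, (φ x : ℝ≥0∞) ≤ g x) → ∫⁻ x, φ x ∂μ ≠ ∞ →
      ∫⁻ x, φ x ∂μ ≤ L) :
    ∫⁻ x, g x ∂μ ≤ L := by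
  rw [lintegral_eq_nnreal]
  refine iSup₂_le fun φ hφ => le_of_forall_lt fun c hc => ?_
  rw [← SimpleFunc.lintegral_eq_lintegral] at hc
  simp only [SimpleFunc.map_apply] at hc
  obtain ⟨ψ, hψφ, hψ, hcψ⟩ := SimpleFunc.exists_lt_lintegral_simpleFunc_of_lt_lintegral hc
  exact hcψ.trans_le (h ψ (fun x => (ENNReal.coe_le_coe.2 (hψφ x)).trans (hφ x)) hψ.ne)

/-- The vector-valued bound for `r < p`, by duality and the weighted inequality. -/
lemma exists_lintegral_tsum_cubeMaximal_rpow_le_of_lt (d : ℕ) {r p : ℝ} (hr : 1 < r)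
    (hrp : r < p) :
    ∃ C : ℝ≥0, ∀ f : ℕ → (Fin d → ℝ) → ℝ≥0∞, (∀ n, Measurable (f n)) →
      ∫⁻ x, (∑' n, cubeMaximal (f n) x ^ r) ^ (p / r) ≤
        C * ∫⁻ x, (∑' n, f n x ^ r) ^ (p / r) := by
  have hr0 : 0 < r := one_pos.trans hr
  set s := p / r
  have hs : 1 < s := (one_lt_div hr0).2 hrp
  have hs0 : 0 < s := one_pos.trans hs
  have hθ : 0 < 1 - 1 / s := sub_pos.2 ((div_lt_one hs0).2 hs)
  have hq : 1 < 1 / (1 - 1 / s) := by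
    rw [one_lt_div hθ]
    have : 0 < 1 / s := by positivity
    linarith
  obtain ⟨A, hA⟩ := exists_lintegral_cubeMaximal_rpow_mul_le d hr
  obtain ⟨B, hB⟩ := exists_lintegral_cubeMaximal_rpow_le d hq
  refine ⟨(A * B ^ (1 - 1 / s)) ^ s,
    fun f hf => lintegral_le_of_forall_simpleFunc fun φ hφ hfin => ?_⟩
  rw [ENNReal.coe_rpow_of_nonneg _ hs0.le]
  refine ENNReal.le_rpow_mul_of_le_mul_rpow hs0 hfin ?_
  set F : (Fin d → ℝ) → ℝ≥0∞ := fun x => ∑' n, f n x ^ r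
  have hFm : Measurable F := Measurable.tsum fun n => (hf n).pow_const r
  have hφm : Measurable fun x => (φ x : ℝ≥0∞) := φ.measurable.coe_nnreal_ennreal
  set w : (Fin d → ℝ) → ℝ≥0∞ := fun x => (φ x : ℝ≥0∞) ^ (1 - 1 / s)
  have hwm : Measurable w := hφm.pow_const _
  have hφw : ∀ x, (φ x : ℝ≥0∞) ≤ (∑' n, cubeMaximal (f n) x ^ r) * w x := fun x => by
    calc (φ x : ℝ≥0∞) = (φ x : ℝ≥0∞) ^ (1 / s) * w x := by
          rw [← ENNReal.rpow_add_of_nonneg _ _ (by positivity) hθ.le, add_sub_cancel,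
            ENNReal.rpow_one]
      _ ≤ _ := by
          gcongr
          rw [one_div, ENNReal.rpow_inv_le_iff hs0]
          exact hφ x
  have hMw : ∀ x, (cubeMaximal w x ^ (1 / (1 - 1 / s))) ^ (1 - 1 / s) = cubeMaximal w x :=
    fun x => by rw [← ENNReal.rpow_mul, one_div_mul_cancel hθ.ne', ENNReal.rpow_one]
  have hFs : ∀ x, (F x ^ s) ^ (1 / s) = F x :=
    fun x => by rw [← ENNReal.rpow_mul, mul_one_div_cancel hs0.ne', ENNReal.rpow_one]
  have hw : ∀ x, w x ^ (1 / (1 - 1 / s)) = φ x :=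
    fun x => by rw [← ENNReal.rpow_mul, mul_one_div_cancel hθ.ne', ENNReal.rpow_one]
  have hBw := hB w hwm
  simp only [hw] at hBw
  calc ∫⁻ x, (φ x : ℝ≥0∞)
      ≤ ∫⁻ x, ∑' n, cubeMaximal (f n) x ^ r * w x := by
        refine lintegral_mono fun x => (hφw x).trans_eq ?_
        rw [ENNReal.tsum_mul_right]
    _ = ∑' n, ∫⁻ x, cubeMaximal (f n) x ^ r * w x :=
        lintegral_tsum fun n =>
          (((measurable_cubeMaximal (f n)).pow_const r).mul hwm).aemeasurable
    _ ≤ ∑' n, A * ∫⁻ x, f n x ^ r * cubeMaximal w x :=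
        ENNReal.tsum_le_tsum fun n => hA _ _ (hf n) hwm
    _ = A * ∫⁻ x, F x * cubeMaximal w x := by
        simp only [F, ENNReal.tsum_mul_left, ← ENNReal.tsum_mul_right]
        congr 1
        exact (lintegral_tsum fun n =>
          (((hf n).pow_const r).mul (measurable_cubeMaximal w)).aemeasurable).symm
    _ = A * ∫⁻ x, (F x ^ s) ^ (1 / s) *
          (cubeMaximal w x ^ (1 / (1 - 1 / s))) ^ (1 - 1 / s) := by simp only [hMw, hFs]
    _ ≤ A * ((∫⁻ x, F x ^ s) ^ (1 / s) *
          (∫⁻ x, cubeMaximal w x ^ (1 / (1 - 1 / s))) ^ (1 - 1 / s)) :=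
        mul_le_mul_right (ENNReal.lintegral_mul_norm_pow_le (hFm.pow_const s).aemeasurable
          ((measurable_cubeMaximal w).pow_const _).aemeasurable (by positivity) hθ.le
          (add_sub_cancel _ _)) _
    _ ≤ A * ((∫⁻ x, F x ^ s) ^ (1 / s) * (B * ∫⁻ x, φ x) ^ (1 - 1 / s)) := by gcongr
    _ = _ := by
        rw [ENNReal.mul_rpow_of_nonneg _ _ hθ.le, ENNReal.coe_mul,
          ENNReal.coe_rpow_of_nonneg _ hθ.le]
        ring

lemma exists_lintegral_tsum_cubeMaximal_rpow_le (d : ℕ) {r p : ℝ} (hr : 1 < r) (hp : 1 < p) :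
    ∃ C : ℝ≥0, ∀ f : ℕ → (Fin d → ℝ) → ℝ≥0∞, (∀ n, Measurable (f n)) →
      ∫⁻ x, (∑' n, f n x ^ r) ^ (p / r) ≠ ∞ →
      ∫⁻ x, (∑' n, cubeMaximal (f n) x ^ r) ^ (p / r) ≤
        C * ∫⁻ x, (∑' n, f n x ^ r) ^ (p / r) := by
  rcases le_or_gt p r with h | h
  · exact exists_lintegral_tsum_cubeMaximal_rpow_le_of_le d hp h
  · obtain ⟨C, hC⟩ := exists_lintegral_tsum_cubeMaximal_rpow_le_of_lt d hr h
    exact ⟨C, fun f hf _ => hC f hf⟩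

end VectorValued

lemma HLmax_eq_cubeMaximal (d : ℕ) (f : (Fin d → ℝ) → ℝ) (x : Fin d → ℝ) :
    HLmax d f x = cubeMaximal (fun y => ENNReal.ofReal |f y|) x := by
  refine iSup_congr fun r => iSup_congr fun hr => ?_
  have : {y : Fin d → ℝ | ∀ j, |y j - x j| < r} = Metric.ball x r := by
    ext y
    simp [dist_pi_lt_iff hr, Real.dist_eq]
  rw [this]

/-- Classical Fefferman–Stein inequalities for the Hardy–Littlewood maximal operator:
strong type. -/
theorem fefferman_stein_classical_strong
    (d : ℕ) (hd : 1 ≤ d) (r p : ℝ) (hr : 1 < r) (hp : 1 < p) :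
    ∃ C : ℝ, 0 < C ∧ ∀ f : ℕ → (Fin d → ℝ) → ℝ, (∀ n, Measurable (f n)) →
      (∫⁻ x, ((∑' n, ENNReal.ofReal (|f n x|) ^ r) ^ (1/r)) ^ p ∂(volume)) ^ (1/p) < ∞ →
      (∫⁻ x, ((∑' n, HLmax d (f n) x ^ r) ^ (1/r)) ^ p ∂(volume)) ^ (1/p) ≤
        ENNReal.ofReal C *
          (∫⁻ x, ((∑' n, ENNReal.ofReal (|f n x|) ^ r) ^ (1/r)) ^ p ∂(volume)) ^ (1/p) := by
  obtain ⟨C, hC⟩ := exists_lintegral_tsum_cubeMaximal_rpow_le d hr hp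
  have hp0 : 0 < p := one_pos.trans hp
  refine ⟨C ^ (1 / p) + 1, by positivity, fun f hf hfin => ?_⟩
  simp only [← ENNReal.rpow_mul, one_div_mul_eq_div, HLmax_eq_cubeMaximal] at hfin ⊢
  have hfin' : ∫⁻ x, (∑' n, ENNReal.ofReal |f n x| ^ r) ^ (p / r) ≠ ∞ := fun h => by
    simp [h, hp0] at hfin
  have h := hC (fun n x => ENNReal.ofReal |f n x|) (fun n => (hf n).abs.ennreal_ofReal) hfin'
  calc _ ≤ (C * ∫⁻ x, (∑' n, ENNReal.ofReal |f n x| ^ r) ^ (p / r)) ^ (1 / p) := by gcongr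
    _ = ENNReal.ofReal (C ^ (1 / p)) *
          (∫⁻ x, (∑' n, ENNReal.ofReal |f n x| ^ r) ^ (p / r)) ^ (1 / p) := by
        rw [ENNReal.mul_rpow_of_nonneg _ _ (by positivity),
          ← ENNReal.ofReal_rpow_of_nonneg C.coe_nonneg (by positivity), ENNReal.ofReal_coe_nnreal]
    _ ≤ _ := by
        gcongr
        linarith
end
end

section
/- Let 1 < r < ∞ and let (f_n)_{n≥1} be a sequence of measurable functions on ℝ^d such that (Σ_{n=1}^∞ |f_n(·)|^r)^{1/r} ∈ L^1(ℝ^d; dm). Then for every λ > 0, m({x ∈ ℝ^d : (Σ_{n=1}^∞ |M f_n(x)|^r)^{1/r} > λ}) ≤ (C/λ) ‖(Σ_{n=1}^∞ |f_n(·)|^r)^{1/r}‖_1, where C = C(r) is independent of (f_n) and λ. -/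
noncomputable section
open MeasureTheory Set Real
open scoped ENNReal NNReal

open Metric

/-- The centred maximal function over balls of the sup metric, for `ℝ≥0∞`-valued functions. -/
def ballMax {d : ℕ} (f : (Fin d → ℝ) → ℝ≥0∞) (x : Fin d → ℝ) : ℝ≥0∞ :=
  ⨆ (s : ℝ) (_ : 0 < s), (volume (ball x s))⁻¹ * ∫⁻ y in ball x s, f y

section Balls

variable {d : ℕ}

lemma setOf_abs_sub_lt_eq_ball (x : Fin d → ℝ) {s : ℝ} (hs : 0 < s) :
    {y : Fin d → ℝ | ∀ j, |y j - x j| < s} = ball x s := by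
  ext y
  simp [mem_ball, dist_pi_lt_iff hs, Real.dist_eq]

lemma HLmax_eq_ballMax (f : (Fin d → ℝ) → ℝ) (x : Fin d → ℝ) :
    HLmax d f x = ballMax (fun y => ENNReal.ofReal |f y|) x := by
  unfold HLmax ballMax
  refine iSup_congr fun s => iSup_congr fun hs => ?_
  rw [setOf_abs_sub_lt_eq_ball x hs]

lemma volume_closedBall_eq_volume_ball (x y : Fin d → ℝ) {s : ℝ} (hs : 0 < s) :
    volume (closedBall x s) = volume (ball y s) := by
  rw [Real.volume_pi_closedBall x hs.le, Real.volume_pi_ball y hs]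

lemma volume_ball_mul (x y : Fin d → ℝ) {k s : ℝ} (hk : 0 < k) (hs : 0 < s) :
    volume (ball x (k * s)) = ENNReal.ofReal k ^ d * volume (ball y s) := by
  rw [Real.volume_pi_ball x (by positivity), Real.volume_pi_ball y hs, Fintype.card_fin,
    ← ENNReal.ofReal_pow hk.le, ← ENNReal.ofReal_mul (by positivity), ← mul_pow]
  ring_nf

lemma volume_ball_ne_zero (x : Fin d → ℝ) {s : ℝ} (hs : 0 < s) : volume (ball x s) ≠ 0 :=
  (measure_ball_pos _ _ hs).ne'

lemma volume_ball_ne_top (x : Fin d → ℝ) (s : ℝ) : volume (ball x s) ≠ ∞ :=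
  measure_ball_lt_top.ne

lemma ball_ae_eq_closedBall (x : Fin d → ℝ) {s : ℝ} (hs : 0 < s) :
    ball x s =ᵐ[volume] closedBall x s :=
  ae_eq_of_subset_of_measure_ge ball_subset_closedBall
    (volume_closedBall_eq_volume_ball x x hs).le measurableSet_ball.nullMeasurableSet
    measure_closedBall_lt_top.ne

lemma volume_biUnion_closedBall_le {u : Set (Fin d → ℝ)} (hu : u.Countable)
    {ρ : (Fin d → ℝ) → ℝ} (hρ : ∀ x ∈ u, 0 < ρ x) {k : ℝ} (hk : 0 < k) :
    volume (⋃ x ∈ u, closedBall x (k * ρ x)) ≤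
      ENNReal.ofReal k ^ d * ∑' x : u, volume (closedBall (x : Fin d → ℝ) (ρ x)) := by
  refine (measure_biUnion_le _ hu _).trans ?_
  rw [← ENNReal.tsum_mul_left]
  refine ENNReal.tsum_le_tsum fun x => le_of_eq ?_
  have h := hρ x x.2
  rw [volume_closedBall_eq_volume_ball x.1 x.1 (by positivity),
    volume_closedBall_eq_volume_ball x.1 x.1 h, volume_ball_mul x.1 x.1 hk h]

end Balls

section BallMax

variable {d : ℕ} {f g : (Fin d → ℝ) → ℝ≥0∞} {x : Fin d → ℝ} {c : ℝ≥0∞} {s : ℝ}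

lemma ballMax_le_iff : ballMax f x ≤ c ↔
    ∀ s, 0 < s → ∫⁻ y in ball x s, f y ≤ c * volume (ball x s) := by
  simp only [ballMax, iSup_le_iff]
  refine forall_congr' fun s => forall_congr' fun hs => ?_
  rw [mul_comm, ← div_eq_mul_inv, ENNReal.div_le_iff (volume_ball_ne_zero x hs)
    (volume_ball_ne_top x s)]

lemma setLIntegral_ball_le (hs : 0 < s) :
    ∫⁻ y in ball x s, f y ≤ ballMax f x * volume (ball x s) :=
  ballMax_le_iff.1 le_rfl s hs

lemma lt_ballMax_iff : c < ballMax f x ↔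
    ∃ s, 0 < s ∧ c * volume (ball x s) < ∫⁻ y in ball x s, f y := by
  rw [← not_le, ballMax_le_iff]
  push Not
  rfl

lemma ballMax_mono (h : f ≤ g) : ballMax f x ≤ ballMax g x :=
  ballMax_le_iff.2 fun _ hs => (lintegral_mono h).trans (setLIntegral_ball_le hs)

lemma ballMax_le_add_const (h : ∀ y, f y ≤ g y + c) : ballMax f x ≤ ballMax g x + c := by
  refine ballMax_le_iff.2 fun s hs => (lintegral_mono h).trans ?_
  rw [lintegral_add_right _ measurable_const, setLIntegral_const, add_mul]
  gcongr
  exact setLIntegral_ball_le hs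

lemma isOpen_setOf_lt_ballMax (f : (Fin d → ℝ) → ℝ≥0∞) (c : ℝ≥0∞) :
    IsOpen {x | c < ballMax f x} := by
  refine Metric.isOpen_iff.2 fun x hx => ?_
  obtain ⟨s, hs, hlt⟩ := lt_ballMax_iff.1 hx
  have hU : ⋃ n : ℕ, ball x (s - 1 / ((n : ℝ) + 1)) = ball x s := by
    refine subset_antisymm (iUnion_subset fun n => ball_subset_ball ?_) fun y hy => ?_
    · have : 0 < 1 / ((n : ℝ) + 1) := by positivity
      linarith
    · obtain ⟨n, hn⟩ := exists_nat_one_div_lt (sub_pos.2 (mem_ball.1 hy))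
      exact mem_iUnion.2 ⟨n, mem_ball.2 (by linarith)⟩
  rw [← hU, setLIntegral_iUnion_of_directed, lt_iSup_iff, hU] at hlt
  · obtain ⟨n, hn⟩ := hlt
    refine ⟨1 / ((n : ℝ) + 1), by positivity, fun y hy => lt_ballMax_iff.2 ⟨s, hs, ?_⟩⟩
    have hv : volume (ball y s) = volume (ball x s) := by
      rw [Real.volume_pi_ball y hs, Real.volume_pi_ball x hs]
    rw [hv]
    refine hn.trans_le (lintegral_mono_set (ball_subset_ball' ?_))
    rw [mem_ball, dist_comm] at hy
    linarith
  · refine directed_of_isDirected_le fun m n hmn => ball_subset_ball ?_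
    have : 1 / ((n : ℝ) + 1) ≤ 1 / ((m : ℝ) + 1) := Nat.one_div_le_one_div hmn
    linarith

lemma measurable_ballMax (f : (Fin d → ℝ) → ℝ≥0∞) : Measurable (ballMax f) :=
  measurable_of_Ioi fun c => (isOpen_setOf_lt_ballMax f c).measurableSet

lemma ae_le_ballMax (hf : Measurable f) (hfi : ∫⁻ y, f y ≠ ∞) : ∀ᵐ x, f x ≤ ballMax f x := by
  filter_upwards [(Besicovitch.vitaliFamily (volume : Measure (Fin d → ℝ))).ae_tendsto_lintegral_div'
    hf hfi] with x hx
  refine le_of_tendsto (hx.comp (Besicovitch.tendsto_filterAt volume x)) ?_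
  filter_upwards [self_mem_nhdsWithin] with s hs
  have hs : 0 < s := hs
  simp only [Function.comp_apply]
  rw [← setLIntegral_congr (ball_ae_eq_closedBall x hs), volume_closedBall_eq_volume_ball x x hs]
  exact ENNReal.div_le_of_le_mul (setLIntegral_ball_le hs)

end BallMax

section Covering

variable {d : ℕ} {f : (Fin d → ℝ) → ℝ≥0∞} {c : ℝ≥0∞}

lemma le_max_of_mul_volume_ball_lt (hd : 1 ≤ d) (hfi : ∫⁻ y, f y ≠ ∞) (hc : c ≠ 0) (hc' : c ≠ ∞)
    {x : Fin d → ℝ} {s : ℝ} (hs : 0 < s)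
    (h : c * volume (ball x s) < ∫⁻ y in ball x s, f y) :
    s ≤ max 1 (c⁻¹ * ∫⁻ y, f y).toReal := by
  by_contra! hlt
  obtain ⟨h1, h2⟩ := max_lt_iff.1 hlt
  have h3 : volume (ball x s) ≤ c⁻¹ * ∫⁻ y, f y := by
    rw [mul_comm, ← div_eq_mul_inv, ENNReal.le_div_iff_mul_le (.inl hc) (.inl hc'), mul_comm]
    exact h.le.trans (setLIntegral_le_lintegral _ _)
  have h4 := ENNReal.toReal_mono (ENNReal.mul_ne_top (ENNReal.inv_ne_top.2 hc) hfi) h3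
  rw [Real.volume_pi_ball x hs, Fintype.card_fin, ENNReal.toReal_ofReal (by positivity)] at h4
  have h5 : 2 * s ≤ (2 * s) ^ d := le_self_pow₀ (by linarith) (by omega)
  linarith

/-- A Vitali-type covering of a superlevel set of the maximal function by enlargements of disjoint
balls on which the average of `f` is comparable to the level. -/
lemma exists_covering_setOf_lt_ballMax (hd : 1 ≤ d) (hfi : ∫⁻ y, f y ≠ ∞)
    (hc : c ≠ 0) (hc' : c ≠ ∞) :
    ∃ (u : Set (Fin d → ℝ)) (ρ : (Fin d → ℝ) → ℝ), u.Countable ∧ (∀ x ∈ u, 0 < ρ x) ∧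
      (u.PairwiseDisjoint fun x => closedBall x (ρ x)) ∧
      (∑' x : u, volume (closedBall (x : Fin d → ℝ) (ρ x)) ≤ c⁻¹ * ∫⁻ y, f y) ∧
      (∀ x ∈ u, ∫⁻ y in closedBall x (5 * ρ x), f y ≤
        ENNReal.ofReal 5 ^ d * c * volume (closedBall x (ρ x))) ∧
      {x | c < ballMax f x} ⊆ ⋃ x ∈ u, closedBall x (5 * ρ x) := by
  set S : (Fin d → ℝ) → Set ℝ :=
    fun x => {s | 0 < s ∧ c * volume (ball x s) < ∫⁻ y in ball x s, f y} with hS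
  have hbdd : ∀ x, ∀ s ∈ S x, s ≤ max 1 (c⁻¹ * ∫⁻ y, f y).toReal := fun x s hs =>
    le_max_of_mul_volume_ball_lt hd hfi hc hc' hs.1 hs.2
  have hex : ∀ x, ∃ s, c < ballMax f x → s ∈ S x ∧ 5 * s ∉ S x := by
    intro x
    by_cases hx : c < ballMax f x
    · obtain ⟨s₀, hs₀⟩ := lt_ballMax_iff.1 hx
      have hB : BddAbove (S x) := ⟨_, hbdd x⟩
      have hpos : 0 < sSup (S x) := hs₀.1.trans_le (le_csSup hB hs₀)
      obtain ⟨s, hs, hlt⟩ := exists_lt_of_lt_csSup ⟨s₀, hs₀⟩ (show sSup (S x) / 5 < sSup (S x) by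
        linarith)
      refine ⟨s, fun _ => ⟨hs, fun h5 => ?_⟩⟩
      have := le_csSup hB h5
      linarith
    · exact ⟨0, fun h => absurd h hx⟩
  choose ρ hρ using hex
  obtain ⟨u, hut, hdisj, hcov⟩ := Vitali.exists_disjoint_subfamily_covering_enlargement_closedBall
    {x | c < ballMax f x} id ρ _ (fun x hx => hbdd x _ (hρ x hx).1) 5 (by norm_num)
  have hpos : ∀ x ∈ u, 0 < ρ x := fun x hx => (hρ x (hut hx)).1.1
  have hcount : u.Countable := hdisj.countable_of_nonempty_interior fun x hx =>
    (nonempty_ball.2 (hpos x hx)).mono ball_subset_interior_closedBall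
  refine ⟨u, ρ, hcount, hpos, hdisj, ?_, fun x hx => ?_, fun x hx => ?_⟩
  · have := hcount.to_subtype
    rw [mul_comm, ← div_eq_mul_inv, ENNReal.le_div_iff_mul_le (.inl hc) (.inl hc'), mul_comm,
      ← ENNReal.tsum_mul_left]
    calc ∑' x : u, c * volume (closedBall (x : Fin d → ℝ) (ρ x))
        ≤ ∑' x : u, ∫⁻ y in closedBall (x : Fin d → ℝ) (ρ x), f y := by
          refine ENNReal.tsum_le_tsum fun x => ?_
          rw [volume_closedBall_eq_volume_ball _ x.1 (hpos x x.2)]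
          exact (hρ x (hut x.2)).1.2.le.trans (lintegral_mono_set ball_subset_closedBall)
      _ = ∫⁻ y in ⋃ x : u, closedBall (x : Fin d → ℝ) (ρ x), f y :=
          (lintegral_iUnion (fun _ => measurableSet_closedBall) (hdisj.subtype _ _) f).symm
      _ ≤ ∫⁻ y, f y := setLIntegral_le_lintegral _ _
  · have h := hpos x hx
    have h5 := (hρ x (hut hx)).2
    simp only [hS, mem_ofPred_eq, not_and, not_lt] at h5
    rw [← setLIntegral_congr (ball_ae_eq_closedBall x (by positivity)),
      volume_closedBall_eq_volume_ball x x h, mul_comm (_ ^ d), mul_assoc,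
      ← volume_ball_mul x x (by norm_num) h]
    exact h5 (by positivity)
  · obtain ⟨b, hb, hsub⟩ := hcov x hx
    exact mem_iUnion₂.2 ⟨b, hb, hsub (mem_closedBall_self (hρ x hx).1.1.le)⟩

/-- The weak type `(1,1)` estimate for the maximal function. -/
lemma volume_setOf_lt_ballMax_le (hd : 1 ≤ d) (f : (Fin d → ℝ) → ℝ≥0∞)
    (hc : c ≠ 0) (hc' : c ≠ ∞) :
    volume {x | c < ballMax f x} ≤ ENNReal.ofReal 5 ^ d * (c⁻¹ * ∫⁻ y, f y) := by
  by_cases hfi : ∫⁻ y, f y = ∞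
  · rw [hfi, ENNReal.mul_top (ENNReal.inv_ne_zero.2 hc'), ENNReal.mul_top (by simp)]
    exact le_top
  obtain ⟨u, ρ, hu, hρ, -, hsum, -, hcov⟩ := exists_covering_setOf_lt_ballMax hd hfi hc hc'
  refine (measure_mono hcov).trans ((volume_biUnion_closedBall_le hu hρ (by norm_num)).trans ?_)
  gcongr

end Covering

section StrongType

/-- The layer cake formula for a single value. -/
lemma lintegral_Ioi_indicator_rpow (g : ℝ≥0∞) {s : ℝ} (hs : 0 < s) :
    ∫⁻ t in Ioi (0 : ℝ), {t : ℝ | ENNReal.ofReal t < g}.indicator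
      (fun t => ENNReal.ofReal (t ^ (s - 1))) t = g ^ s * ENNReal.ofReal s⁻¹ := by
  have hint : ∀ b : ℝ, 0 ≤ b → ∫⁻ t in Ioo 0 b, ENNReal.ofReal (t ^ (s - 1)) =
      ENNReal.ofReal b ^ s * ENNReal.ofReal s⁻¹ := by
    intro b hb
    rw [setLIntegral_congr Ioo_ae_eq_Ioc, ← ofReal_integral_eq_lintegral_ofReal,
      ← intervalIntegral.integral_of_le hb, integral_rpow (.inl (by linarith)),
      ENNReal.ofReal_rpow_of_nonneg hb hs.le, ← ENNReal.ofReal_mul (by positivity)]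
    · simp [Real.zero_rpow hs.ne', div_eq_mul_inv]
    · exact (intervalIntegrable_iff_integrableOn_Ioc_of_le hb).1
        (intervalIntegral.intervalIntegrable_rpow' (by linarith))
    · filter_upwards [ae_restrict_mem measurableSet_Ioc] with t ht
      exact Real.rpow_nonneg ht.1.le _
  have hm : MeasurableSet {t : ℝ | ENNReal.ofReal t < g} :=
    measurableSet_lt ENNReal.measurable_ofReal measurable_const
  rw [lintegral_indicator hm, Measure.restrict_restrict hm]
  induction g with
  | top =>
    rw [ENNReal.top_rpow_of_pos hs, ENNReal.top_mul (by simpa using hs)]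
    refine ENNReal.eq_top_of_forall_nnreal_le fun b => ?_
    have hbs : (0 : ℝ) ≤ b * s := by positivity
    have h := hint ((b * s : ℝ) ^ s⁻¹) (by positivity)
    rw [ENNReal.ofReal_rpow_of_nonneg (by positivity) hs.le, Real.rpow_inv_rpow hbs hs.ne',
      ← ENNReal.ofReal_mul hbs, mul_inv_cancel_right₀ hs.ne', ENNReal.ofReal_coe_nnreal] at h
    rw [← h]
    refine lintegral_mono_set fun t ht => ⟨?_, ht.1⟩
    exact ENNReal.ofReal_lt_top
  | coe b =>
    rw [← ENNReal.ofReal_coe_nnreal, ← hint b b.2]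
    congr 2
    ext t
    simp only [mem_inter_iff, mem_ofPred_eq, mem_Ioi, mem_Ioo]
    constructor
    · rintro ⟨h1, h2⟩
      exact ⟨h2, (ENNReal.ofReal_lt_ofReal_iff_of_nonneg h2.le).1 h1⟩
    · rintro ⟨h1, h2⟩
      exact ⟨(ENNReal.ofReal_lt_ofReal_iff_of_nonneg h1.le).2 h2, h1⟩

variable {d : ℕ} {f : (Fin d → ℝ) → ℝ≥0∞}

lemma volume_setOf_ofReal_lt_ballMax_le (hd : 1 ≤ d) (f : (Fin d → ℝ) → ℝ≥0∞) {t : ℝ} (ht : 0 < t) :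
    volume {x | ENNReal.ofReal t < ballMax f x} ≤
      2 * ENNReal.ofReal 5 ^ d * ((ENNReal.ofReal t)⁻¹ *
        ∫⁻ x, {x | ENNReal.ofReal t < 2 * f x}.indicator f x) := by
  set c : ℝ≥0∞ := ENNReal.ofReal t / 2 with hc
  have hc2 : c + c = ENNReal.ofReal t := ENNReal.add_halves _
  have hc0 : c ≠ 0 := by simp [hc, ht]
  have hct : c ≠ ∞ := by simp [hc, ENNReal.div_eq_top]
  have hsub : {x | ENNReal.ofReal t < ballMax f x} ⊆
      {x | c < ballMax ({x | ENNReal.ofReal t < 2 * f x}.indicator f) x} := by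
    intro x hx
    simp only [mem_ofPred_eq] at hx ⊢
    have h := ballMax_le_add_const (f := f) (x := x) (c := c)
      (g := {x | ENNReal.ofReal t < 2 * f x}.indicator f) fun y => by
        by_cases hy : ENNReal.ofReal t < 2 * f y
        · rw [indicator_of_mem (by exact hy)]
          exact le_self_add
        · rw [indicator_of_notMem (by exact hy), zero_add, hc,
            ENNReal.le_div_iff_mul_le (by simp) (by simp), mul_comm]
          exact not_lt.1 hy
    by_contra! hle
    have := h.trans (add_le_add_left hle c)
    rw [hc2] at this
    exact (hx.trans_le this).false
  refine (measure_mono hsub).trans ((volume_setOf_lt_ballMax_le hd _ hc0 hct).trans (le_of_eq ?_))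
  rw [hc, ENNReal.inv_div (by simp) (by simp), div_eq_mul_inv]
  ring

lemma lintegral_ballMax_rpow_le (hd : 1 ≤ d) {r : ℝ} (hr : 1 < r) (hf : Measurable f) :
    ∫⁻ x, ballMax f x ^ r ≤ ENNReal.ofReal r * (2 * ENNReal.ofReal 5 ^ d) * 2 ^ (r - 1) *
      ENNReal.ofReal (r - 1)⁻¹ * ∫⁻ x, f x ^ r := by
  have hr0 : 0 < r := by linarith
  have hmt : Measurable fun t : ℝ => ENNReal.ofReal (t ^ (r - 1)) := by fun_prop
  have hmt' : Measurable fun t : ℝ => ENNReal.ofReal (t ^ (r - 1 - 1)) := by fun_prop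
  have hswap : ∫⁻ x, ballMax f x ^ r * ENNReal.ofReal r⁻¹ =
      ∫⁻ t in Ioi (0 : ℝ), ENNReal.ofReal (t ^ (r - 1)) *
        volume {x | ENNReal.ofReal t < ballMax f x} := by
    simp_rw [← lintegral_Ioi_indicator_rpow _ hr0]
    rw [lintegral_lintegral_swap]
    · refine lintegral_congr fun t => ?_
      have hm : MeasurableSet {x | ENNReal.ofReal t < ballMax f x} :=
        (isOpen_setOf_lt_ballMax f _).measurableSet
      rw [← lintegral_indicator_const hm]
      rfl
    · exact ((hmt.comp measurable_snd).indicator (measurableSet_lt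
        (ENNReal.measurable_ofReal.comp measurable_snd)
        ((measurable_ballMax f).comp measurable_fst))).aemeasurable
  have hswap' : ∫⁻ t in Ioi (0 : ℝ), ∫⁻ x, f x * {t : ℝ | ENNReal.ofReal t < 2 * f x}.indicator
      (fun t => ENNReal.ofReal (t ^ (r - 1 - 1))) t =
      2 ^ (r - 1) * ENNReal.ofReal (r - 1)⁻¹ * ∫⁻ x, f x ^ r := by
    rw [lintegral_lintegral_swap]
    · rw [← lintegral_const_mul _ (by fun_prop)]
      refine lintegral_congr fun x => ?_
      rw [lintegral_const_mul, lintegral_Ioi_indicator_rpow _ (by linarith),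
        ENNReal.mul_rpow_of_nonneg _ _ (by linarith)]
      · have : f x ^ r = f x * f x ^ (r - 1) := by
          conv_rhs => rw [← ENNReal.rpow_one (f x), ← ENNReal.rpow_mul, one_mul,
            ← ENNReal.rpow_add_of_nonneg _ _ zero_le_one (by linarith), add_sub_cancel]
        rw [this]
        ring
      · exact hmt'.indicator (measurableSet_lt ENNReal.measurable_ofReal measurable_const)
    · exact ((hf.comp measurable_snd).mul ((hmt'.comp measurable_fst).indicator (measurableSet_lt
        (ENNReal.measurable_ofReal.comp measurable_fst)
        ((hf.comp measurable_snd).const_mul 2)))).aemeasurable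
  calc ∫⁻ x, ballMax f x ^ r
      = ENNReal.ofReal r * ∫⁻ x, ballMax f x ^ r * ENNReal.ofReal r⁻¹ := by
        rw [lintegral_mul_const _ ((measurable_ballMax f).pow_const r), mul_left_comm,
          ← ENNReal.ofReal_mul hr0.le, mul_inv_cancel₀ hr0.ne', ENNReal.ofReal_one, mul_one]
    _ ≤ ENNReal.ofReal r * ∫⁻ t in Ioi (0 : ℝ), (2 * ENNReal.ofReal 5 ^ d) *
          ∫⁻ x, f x * {t : ℝ | ENNReal.ofReal t < 2 * f x}.indicator
            (fun t => ENNReal.ofReal (t ^ (r - 1 - 1))) t := by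
        rw [hswap]
        gcongr ENNReal.ofReal r * ?_
        refine setLIntegral_mono' measurableSet_Ioi fun t (ht : 0 < t) => ?_
        have hpow : ENNReal.ofReal (t ^ (r - 1)) * (ENNReal.ofReal t)⁻¹ =
            ENNReal.ofReal (t ^ (r - 1 - 1)) := by
          rw [← ENNReal.ofReal_inv_of_pos ht, ← ENNReal.ofReal_mul (by positivity),
            Real.rpow_sub_one ht.ne' (r - 1), div_eq_mul_inv]
        refine (mul_le_mul_right (volume_setOf_ofReal_lt_ballMax_le hd f ht) _).trans
          (le_of_eq ?_)
        have hm : MeasurableSet {x | ENNReal.ofReal t < 2 * f x} :=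
          measurableSet_lt measurable_const (hf.const_mul 2)
        rw [mul_left_comm, ← mul_assoc (ENNReal.ofReal (t ^ (r - 1))), hpow,
          ← lintegral_const_mul _ (hf.indicator hm)]
        congr 1
        refine lintegral_congr fun x => ?_
        by_cases hx : ENNReal.ofReal t < 2 * f x
        · rw [indicator_of_mem (by exact hx), indicator_of_mem (by exact hx), mul_comm]
        · rw [indicator_of_notMem (by exact hx), indicator_of_notMem (by exact hx), mul_zero,
            mul_zero]
    _ = _ := by
        rw [lintegral_const_mul', hswap']
        · ring
        · exact ENNReal.mul_ne_top (by simp) (by simp)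

end StrongType

section Minkowski

variable {α : Type*} [MeasurableSpace α] {μ : Measure α}

lemma le_tsum_rpow_rpow (a : ℕ → ℝ≥0∞) {r : ℝ} (hr : 0 < r) (n : ℕ) :
    a n ≤ (∑' m, a m ^ r) ^ (1 / r) := by
  rw [one_div, ENNReal.le_rpow_inv_iff hr]
  exact ENNReal.le_tsum n

/-- Minkowski's integral inequality for sequences. -/
lemma tsum_lintegral_rpow_le {r : ℝ} (hr : 1 < r) {u : ℕ → α → ℝ≥0∞}
    (hu : ∀ n, Measurable (u n)) :
    ∑' n, (∫⁻ x, u n x ∂μ) ^ r ≤ (∫⁻ x, (∑' n, u n x ^ r) ^ (1 / r) ∂μ) ^ r := by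
  have hr0 : 0 < r := by linarith
  set G := ∫⁻ x, (∑' n, u n x ^ r) ^ (1 / r) ∂μ with hG
  by_cases hGt : G = ∞
  · rw [hGt, ENNReal.top_rpow_of_pos hr0]
    exact le_top
  have ha : ∀ n, ∫⁻ x, u n x ∂μ ≠ ∞ := fun n =>
    ne_top_of_le_ne_top hGt (lintegral_mono fun x => le_tsum_rpow_rpow (fun m => u m x) hr0 n)
  rw [ENNReal.tsum_eq_iSup_sum]
  refine iSup_le fun s => ?_
  set a : ℕ → ℝ≥0∞ := fun n => ∫⁻ x, u n x ∂μ with ha'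
  set T := ∑ n ∈ s, a n ^ r with hT
  have hTt : T ≠ ∞ := ENNReal.sum_ne_top.2 fun n _ => ENNReal.rpow_ne_top_of_nonneg hr0.le (ha n)
  by_cases hT0 : T = 0
  · rw [hT0]
    exact zero_le
  have hpq := (Real.HolderConjugate.conjExponent hr).symm
  set q := Real.conjExponent r with hq
  have hmul : T ≤ T ^ (1 / q) * G := by
    calc T = ∑ n ∈ s, ∫⁻ x, a n ^ (r - 1) * u n x ∂μ := by
          refine Finset.sum_congr rfl fun n _ => ?_
          rw [lintegral_const_mul _ (hu n)]
          conv_rhs => rw [← ENNReal.rpow_one (∫⁻ x, u n x ∂μ),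
            ← ENNReal.rpow_add_of_nonneg _ _ (by linarith) zero_le_one, sub_add_cancel]
      _ = ∫⁻ x, ∑ n ∈ s, a n ^ (r - 1) * u n x ∂μ :=
          (lintegral_finsetSum _ fun n _ => (hu n).const_mul _).symm
      _ ≤ ∫⁻ x, T ^ (1 / q) * (∑' n, u n x ^ r) ^ (1 / r) ∂μ := by
          refine lintegral_mono fun x => ?_
          refine (ENNReal.inner_le_Lp_mul_Lq s _ _ hpq).trans ?_
          have hpow : ∀ n, (a n ^ (r - 1)) ^ q = a n ^ r := fun n => by
            rw [← ENNReal.rpow_mul, hpq.symm.sub_one_mul_conj]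
          simp_rw [hpow]
          gcongr
          exact ENNReal.sum_le_tsum s
      _ = T ^ (1 / q) * G :=
          lintegral_const_mul' _ _ (ENNReal.rpow_ne_top_of_nonneg hpq.one_div_nonneg hTt)
  have hsplit : T = T ^ (1 / q) * T ^ (1 / r) := by
    conv_lhs => rw [← ENNReal.rpow_one T, ← hpq.inv_add_inv_eq_one, ← one_div, ← one_div,
      ENNReal.rpow_add _ _ hT0 hTt]
  have hle : T ^ (1 / r) ≤ G := by
    refine (ENNReal.mul_le_mul_iff_right (a := T ^ (1 / q)) ?_ ?_).1 (hsplit ▸ hmul)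
    · exact (ENNReal.rpow_pos (pos_iff_ne_zero.2 hT0) hTt).ne'
    · exact ENNReal.rpow_ne_top_of_nonneg hpq.one_div_nonneg hTt
  rwa [one_div, ENNReal.rpow_inv_le_iff hr0] at hle

end Minkowski

section Spread

variable {α ι : Type*} [MeasurableSpace α] {μ : Measure α} {B E : ι → Set α} {v : α → ℝ≥0∞}

/-- The function which, for each `i`, spreads the mass of `v` on `E i` uniformly over `B i`. -/
def spread (μ : Measure α) (B E : ι → Set α) (v : α → ℝ≥0∞) (y : α) : ℝ≥0∞ :=
  ∑' i, (B i).indicator (fun _ => (∫⁻ z in E i, v z ∂μ) / μ (B i)) y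

lemma measurable_spread [Countable ι] (hB : ∀ i, MeasurableSet (B i)) :
    Measurable (spread μ B E v) :=
  .tsum fun i => measurable_const.indicator (hB i)

lemma lintegral_spread_rpow [Countable ι] (hB : ∀ i, MeasurableSet (B i))
    (hd : Pairwise (Function.onFun Disjoint B)) {r : ℝ} (hr : 0 < r) :
    ∫⁻ y, spread μ B E v y ^ r ∂μ =
      ∑' i, ((∫⁻ z in E i, v z ∂μ) / μ (B i)) ^ r * μ (B i) := by
  have hpt : ∀ y, spread μ B E v y ^ r =
      ∑' i, (B i).indicator (fun _ => ((∫⁻ z in E i, v z ∂μ) / μ (B i)) ^ r) y := by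
    intro y
    by_cases hy : ∃ i, y ∈ B i
    · obtain ⟨i, hi⟩ := hy
      have hne : ∀ j, j ≠ i → y ∉ B j := fun j hj hyj => disjoint_left.1 (hd hj) hyj hi
      rw [spread, tsum_eq_single i fun j hj => indicator_of_notMem (hne j hj) _,
        tsum_eq_single i fun j hj => indicator_of_notMem (hne j hj) _,
        indicator_of_mem hi, indicator_of_mem hi]
    · push Not at hy
      simp [spread, hy, hr]
  simp_rw [hpt]
  rw [lintegral_tsum fun i => (measurable_const.indicator (hB i)).aemeasurable]
  exact tsum_congr fun i => lintegral_indicator_const (hB i) _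

/-- An `ℓ^r`-valued estimate for `spread`, following from Minkowski's inequality. -/
lemma tsum_lintegral_spread_rpow_le [Countable ι] (hB : ∀ i, MeasurableSet (B i))
    (hd : Pairwise (Function.onFun Disjoint B)) {r : ℝ} (hr : 1 < r) {v : ℕ → α → ℝ≥0∞}
    (hv : ∀ n, Measurable (v n)) :
    ∑' n, ∫⁻ y, spread μ B E (v n) y ^ r ∂μ ≤
      ∑' i, ((∫⁻ z in E i, (∑' n, v n z ^ r) ^ (1 / r) ∂μ) / μ (B i)) ^ r * μ (B i) := by
  have hr0 : 0 < r := by linarith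
  simp_rw [lintegral_spread_rpow hB hd hr0]
  rw [ENNReal.tsum_comm]
  refine ENNReal.tsum_le_tsum fun i => ?_
  simp_rw [ENNReal.div_rpow_of_nonneg _ _ hr0.le, div_eq_mul_inv]
  rw [ENNReal.tsum_mul_right, ENNReal.tsum_mul_right]
  gcongr
  exact tsum_lintegral_rpow_le hr hv

end Spread

section CalderonZygmund

variable {d : ℕ}

/-- Away from enlargements of the balls, the maximal function does not see the redistribution of
mass by `spread`. -/
lemma ballMax_le_ballMax_spread {ι : Type*} [Countable ι] {c : ι → Fin d → ℝ} {ρ : ι → ℝ}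
    (hρ : ∀ i, 0 < ρ i) {E : ι → Set (Fin d → ℝ)} (hE : ∀ i, MeasurableSet (E i))
    (hEs : ∀ i, E i ⊆ closedBall (c i) (5 * ρ i)) (v : (Fin d → ℝ) → ℝ≥0∞)
    {x : Fin d → ℝ} (hx : x ∉ ⋃ i, closedBall (c i) (10 * ρ i)) :
    ballMax v x ≤ (1 + ENNReal.ofReal 3 ^ d) * ballMax (fun y => (⋃ i, E i)ᶜ.indicator v y +
      spread volume (fun i => closedBall (c i) (ρ i)) E v y) x := by
  set h : (Fin d → ℝ) → ℝ≥0∞ := fun y => (⋃ i, E i)ᶜ.indicator v y +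
      spread volume (fun i => closedBall (c i) (ρ i)) E v y with hh
  refine ballMax_le_iff.2 fun s hs => ?_
  have hgood : ∫⁻ y in ball x s \ ⋃ i, E i, v y ≤ ballMax h x * volume (ball x s) := by
    refine le_trans ?_ (setLIntegral_ball_le hs)
    refine le_trans ?_ (lintegral_mono_set (sdiff_subset (t := ⋃ i, E i)))
    refine setLIntegral_mono' (measurableSet_ball.diff (.iUnion hE)) fun y hy => ?_
    rw [hh]
    simp only
    rw [indicator_of_mem (by exact hy.2)]
    exact le_self_add
  have hpiece : ∀ i, ∫⁻ y in ball x s ∩ E i, v y ≤ ∫⁻ y in ball x (3 * s),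
      (closedBall (c i) (ρ i)).indicator
        (fun _ => (∫⁻ z in E i, v z) / volume (closedBall (c i) (ρ i))) y := by
    intro i
    rcases (ball x s ∩ E i).eq_empty_or_nonempty with he | ⟨y, hys, hyE⟩
    · simp [he]
    have h1 : dist y (c i) ≤ 5 * ρ i := hEs i hyE
    have h2 : 10 * ρ i < dist x (c i) := by
      by_contra! hle
      exact hx (mem_iUnion.2 ⟨i, hle⟩)
    have h3 : dist y x < s := hys
    have h4 := dist_triangle_left x (c i) y
    have hsub : closedBall (c i) (ρ i) ⊆ ball x (3 * s) := by
      intro w hw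
      have h5 : dist w (c i) ≤ ρ i := hw
      have h6 := dist_triangle4 w (c i) y x
      rw [dist_comm (c i) y] at h6
      rw [mem_ball]
      have := hρ i
      linarith
    rw [setLIntegral_indicator measurableSet_closedBall, inter_eq_self_of_subset_left hsub,
      setLIntegral_const, ENNReal.div_mul_cancel]
    · exact lintegral_mono_set inter_subset_right
    · exact (measure_closedBall_pos _ _ (hρ i)).ne'
    · exact measure_closedBall_lt_top.ne
  have hbad : ∫⁻ y in ball x s ∩ ⋃ i, E i, v y ≤
      ENNReal.ofReal 3 ^ d * (ballMax h x * volume (ball x s)) := by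
    calc ∫⁻ y in ball x s ∩ ⋃ i, E i, v y
        ≤ ∑' i, ∫⁻ y in ball x s ∩ E i, v y := by
          rw [inter_iUnion]
          exact lintegral_iUnion_le _ _
      _ ≤ ∑' i, ∫⁻ y in ball x (3 * s), (closedBall (c i) (ρ i)).indicator
            (fun _ => (∫⁻ z in E i, v z) / volume (closedBall (c i) (ρ i))) y :=
          ENNReal.tsum_le_tsum hpiece
      _ = ∫⁻ y in ball x (3 * s), spread volume (fun i => closedBall (c i) (ρ i)) E v y :=
          (lintegral_tsum fun i =>
            (measurable_const.indicator measurableSet_closedBall).aemeasurable).symm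
      _ ≤ ∫⁻ y in ball x (3 * s), h y := lintegral_mono fun y => le_add_self
      _ ≤ ballMax h x * volume (ball x (3 * s)) := setLIntegral_ball_le (by positivity)
      _ = _ := by rw [volume_ball_mul x x (by norm_num) hs]; ring
  rw [← lintegral_inter_add_sdiff _ _ (MeasurableSet.iUnion hE)]
  refine (add_le_add hbad hgood).trans (le_of_eq ?_)
  ring

/-- The weak type estimate at a fixed level, with an explicit constant depending on the constant
`A` of the strong type estimate. -/
lemma volume_setOf_lt_tsum_ballMax_le (hd : 1 ≤ d) {r : ℝ} (hr : 1 < r) {A : ℝ≥0∞}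
    (hA : ∀ h : (Fin d → ℝ) → ℝ≥0∞, Measurable h →
      ∫⁻ x, ballMax h x ^ r ≤ A * ∫⁻ x, h x ^ r)
    {v : ℕ → (Fin d → ℝ) → ℝ≥0∞} (hv : ∀ n, Measurable (v n))
    (hfin : ∫⁻ x, (∑' n, v n x ^ r) ^ (1 / r) ≠ ∞) {c : ℝ≥0∞} (hc : c ≠ 0) (hc' : c ≠ ∞) :
    volume {x | c < (∑' n, ballMax (v n) x ^ r) ^ (1 / r)} ≤
      (ENNReal.ofReal 10 ^ d + (1 + ENNReal.ofReal 3 ^ d) ^ r * A * 2 ^ (r - 1) *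
        (1 + (ENNReal.ofReal 5 ^ d) ^ r)) *
        (c⁻¹ * ∫⁻ x, (∑' n, v n x ^ r) ^ (1 / r)) := by
  have hr0 : 0 < r := by linarith
  set F : (Fin d → ℝ) → ℝ≥0∞ := fun x => (∑' n, v n x ^ r) ^ (1 / r) with hF
  have hFm : Measurable F := (Measurable.tsum fun n => (hv n).pow_const r).pow_const _
  have hFr : ∀ x, ∑' n, v n x ^ r = F x ^ r := fun x => by
    rw [hF, one_div, ENNReal.rpow_inv_rpow hr0.ne']
  have hcr0 : c ^ r ≠ 0 := (ENNReal.rpow_pos (pos_iff_ne_zero.2 hc) hc').ne'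
  have hcrt : c ^ r ≠ ∞ := ENNReal.rpow_ne_top_of_nonneg hr0.le hc'
  have hcpow : c ^ (r - 1) = c⁻¹ * c ^ r := by
    rw [ENNReal.rpow_sub _ _ hc hc', ENNReal.rpow_one, div_eq_mul_inv, mul_comm]
  obtain ⟨u, ρ, hu, hρ, hdisj, hsum, havg, hcov⟩ :=
    exists_covering_setOf_lt_ballMax hd (f := F) hfin hc hc'
  have := hu.to_subtype
  have hρ' : ∀ i : u, 0 < ρ i := fun i => hρ i i.2
  have hdisj' : Pairwise (Function.onFun Disjoint fun i : u => closedBall (i : Fin d → ℝ) (ρ i)) :=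
    hdisj.subtype _ _
  set E : u → Set (Fin d → ℝ) := fun i => closedBall (i : Fin d → ℝ) (5 * ρ i) with hEdef
  have hE : ∀ i, MeasurableSet (E i) := fun i => measurableSet_closedBall
  set B : u → Set (Fin d → ℝ) := fun i => closedBall (i : Fin d → ℝ) (ρ i) with hB
  have hBm : ∀ i, MeasurableSet (B i) := fun i => measurableSet_closedBall
  set U : Set (Fin d → ℝ) := ⋃ i, E i with hU
  have hUm : MeasurableSet U := .iUnion hE
  set h : ℕ → (Fin d → ℝ) → ℝ≥0∞ := fun n y => Uᶜ.indicator (v n) y + spread volume B E (v n) y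
    with hh
  have hhm : ∀ n, Measurable (h n) := fun n =>
    ((hv n).indicator hUm.compl).add (measurable_spread hBm)
  set V : Set (Fin d → ℝ) := ⋃ i : u, closedBall (i : Fin d → ℝ) (10 * ρ i) with hV
  have hVle : volume V ≤ ENNReal.ofReal 10 ^ d * (c⁻¹ * ∫⁻ x, F x) := by
    rw [hV, ← biUnion_eq_iUnion u fun x _ => closedBall x (10 * ρ x)]
    refine (volume_biUnion_closedBall_le hu hρ (by norm_num)).trans ?_
    gcongr
  have hFU : ∀ᵐ x, x ∈ Uᶜ → F x ≤ c := by
    filter_upwards [ae_le_ballMax hFm hfin] with x hx hxU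
    refine hx.trans (not_lt.1 fun hlt => hxU ?_)
    rw [hU, hEdef, ← biUnion_eq_iUnion u fun x _ => closedBall x (5 * ρ x)]
    exact hcov hlt
  have hgood : ∑' n, ∫⁻ y, Uᶜ.indicator (v n) y ^ r ≤ c ^ r * (c⁻¹ * ∫⁻ x, F x) := by
    rw [← lintegral_tsum fun n => (((hv n).indicator hUm.compl).pow_const r).aemeasurable,
      ← mul_assoc, mul_comm (c ^ r), ← hcpow, ← lintegral_const_mul _ hFm]
    refine lintegral_mono_ae ?_
    filter_upwards [hFU] with x hx
    by_cases hxU : x ∈ Uᶜ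
    · simp only [indicator_of_mem hxU]
      rw [hFr]
      calc F x ^ r = F x ^ (r - 1) * F x := by
            conv_rhs => rw [← ENNReal.rpow_one (F x), ← ENNReal.rpow_mul, one_mul,
              ← ENNReal.rpow_add_of_nonneg _ _ (by linarith) zero_le_one, sub_add_cancel]
        _ ≤ c ^ (r - 1) * F x := by
            gcongr
            exact hx hxU
    · simp only [indicator_of_notMem hxU, ENNReal.zero_rpow_of_pos hr0, tsum_zero]
      exact zero_le
  have hbad : ∑' n, ∫⁻ y, spread volume B E (v n) y ^ r ≤
      (ENNReal.ofReal 5 ^ d) ^ r * (c ^ r * (c⁻¹ * ∫⁻ x, F x)) := by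
    refine (tsum_lintegral_spread_rpow_le hBm hdisj' hr hv).trans ?_
    calc _ ≤ ∑' i, (ENNReal.ofReal 5 ^ d * c) ^ r * volume (B i) := by
          refine ENNReal.tsum_le_tsum fun i => ?_
          gcongr
          exact ENNReal.div_le_of_le_mul (havg i i.2)
      _ = (ENNReal.ofReal 5 ^ d) ^ r * (c ^ r * ∑' i, volume (B i)) := by
          rw [ENNReal.tsum_mul_left, ENNReal.mul_rpow_of_nonneg _ _ hr0.le, mul_assoc]
      _ ≤ _ := by gcongr
  have hstrong : ∫⁻ x, ∑' n, ballMax (h n) x ^ r ≤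
      A * (2 ^ (r - 1) * (1 + (ENNReal.ofReal 5 ^ d) ^ r)) * (c ^ r * (c⁻¹ * ∫⁻ x, F x)) := by
    rw [lintegral_tsum fun n => ((measurable_ballMax (h n)).pow_const r).aemeasurable]
    calc ∑' n, ∫⁻ x, ballMax (h n) x ^ r
        ≤ ∑' n, A * (2 ^ (r - 1) * ((∫⁻ y, Uᶜ.indicator (v n) y ^ r) +
            ∫⁻ y, spread volume B E (v n) y ^ r)) := by
          refine ENNReal.tsum_le_tsum fun n => (hA _ (hhm n)).trans ?_
          gcongr
          rw [← lintegral_add_left (((hv n).indicator hUm.compl).pow_const r),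
            ← lintegral_const_mul' _ _ (ENNReal.rpow_ne_top_of_nonneg (by linarith) (by simp))]
          exact lintegral_mono fun y => ENNReal.rpow_add_le_mul_rpow_add_rpow _ _ hr.le
      _ = A * (2 ^ (r - 1) * ((∑' n, ∫⁻ y, Uᶜ.indicator (v n) y ^ r) +
            ∑' n, ∫⁻ y, spread volume B E (v n) y ^ r)) := by
          rw [ENNReal.tsum_mul_left, ENNReal.tsum_mul_left, ENNReal.tsum_add]
      _ ≤ A * (2 ^ (r - 1) * (c ^ r * (c⁻¹ * ∫⁻ x, F x) +
            (ENNReal.ofReal 5 ^ d) ^ r * (c ^ r * (c⁻¹ * ∫⁻ x, F x)))) := by gcongr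
      _ = _ := by ring
  have hK : (1 + ENNReal.ofReal 3 ^ d) ^ r ≠ ∞ :=
    ENNReal.rpow_ne_top_of_nonneg hr0.le (by simp)
  have hsub : {x | c < (∑' n, ballMax (v n) x ^ r) ^ (1 / r)} ⊆ V ∪
      {x | c ^ r ≤ (1 + ENNReal.ofReal 3 ^ d) ^ r * ∑' n, ballMax (h n) x ^ r} := by
    intro x hx
    refine or_iff_not_imp_left.2 fun hxV => ?_
    have hx' : c ^ r < ∑' n, ballMax (v n) x ^ r := by
      simpa only [mem_ofPred_eq, one_div, ENNReal.lt_rpow_inv_iff hr0] using hx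
    refine hx'.le.trans ?_
    rw [← ENNReal.tsum_mul_left]
    refine ENNReal.tsum_le_tsum fun n => ?_
    rw [← ENNReal.mul_rpow_of_nonneg _ _ hr0.le]
    gcongr
    exact ballMax_le_ballMax_spread hρ' hE (fun i => subset_rfl) (v n) hxV
  have hcheb : volume {x | c ^ r ≤ (1 + ENNReal.ofReal 3 ^ d) ^ r * ∑' n, ballMax (h n) x ^ r} ≤
      (1 + ENNReal.ofReal 3 ^ d) ^ r * A * 2 ^ (r - 1) * (1 + (ENNReal.ofReal 5 ^ d) ^ r) *
        (c⁻¹ * ∫⁻ x, F x) := by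
    have hm : Measurable fun x => ∑' n, ballMax (h n) x ^ r :=
      .tsum fun n => (measurable_ballMax (h n)).pow_const r
    refine (ENNReal.mul_le_mul_iff_right hcr0 hcrt).1
      ((mul_meas_ge_le_lintegral (hm.const_mul _) (c ^ r)).trans ?_)
    rw [lintegral_const_mul _ hm]
    calc _ ≤ _ := mul_le_mul_right hstrong _
      _ = _ := by ring
  refine (measure_mono hsub).trans ((measure_union_le _ _).trans ?_)
  rw [add_mul]
  exact add_le_add hVle hcheb

end CalderonZygmund

/-- Classical Fefferman–Stein inequalities for the Hardy–Littlewood maximal operator: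
weak type `(1,1)`. -/
theorem fefferman_stein_classical_weak
    (d : ℕ) (hd : 1 ≤ d) (r : ℝ) (hr : 1 < r) :
    ∃ C : ℝ, 0 < C ∧ ∀ f : ℕ → (Fin d → ℝ) → ℝ, (∀ n, Measurable (f n)) →
      (∫⁻ x, (∑' n, ENNReal.ofReal (|f n x|) ^ r) ^ (1/r) ∂(volume)) < ∞ →
      ∀ lam : ℝ, 0 < lam →
      volume {x : Fin d → ℝ | ENNReal.ofReal lam < (∑' n, HLmax d (f n) x ^ r) ^ (1/r)} ≤
        (ENNReal.ofReal C / ENNReal.ofReal lam) *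
          ∫⁻ x, (∑' n, ENNReal.ofReal (|f n x|) ^ r) ^ (1/r) ∂(volume) := by
  set A : ℝ≥0∞ := ENNReal.ofReal r * (2 * ENNReal.ofReal 5 ^ d) * 2 ^ (r - 1) *
    ENNReal.ofReal (r - 1)⁻¹ with hA
  set K : ℝ≥0∞ := ENNReal.ofReal 10 ^ d + (1 + ENNReal.ofReal 3 ^ d) ^ r * A * 2 ^ (r - 1) *
    (1 + (ENNReal.ofReal 5 ^ d) ^ r) with hK
  have hr0 : 0 ≤ r := by linarith
  have h2 : (2 : ℝ≥0∞) ^ (r - 1) ≠ ∞ := ENNReal.rpow_ne_top_of_nonneg (by linarith) (by simp)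
  have hAt : A ≠ ∞ := by
    refine ENNReal.mul_ne_top (ENNReal.mul_ne_top (ENNReal.mul_ne_top (by simp) ?_) h2) (by simp)
    exact ENNReal.mul_ne_top (by simp) (by simp)
  have hKt : K ≠ ∞ := by
    refine ENNReal.add_ne_top.2 ⟨by simp, ENNReal.mul_ne_top (ENNReal.mul_ne_top
      (ENNReal.mul_ne_top ?_ hAt) h2) (ENNReal.add_ne_top.2 ⟨by simp, ?_⟩)⟩
    · exact ENNReal.rpow_ne_top_of_nonneg hr0 (by simp)
    · exact ENNReal.rpow_ne_top_of_nonneg hr0 (by simp)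
  have hK0 : K ≠ 0 := by simp [hK]
  refine ⟨K.toReal, ENNReal.toReal_pos hK0 hKt, fun f hf hfin lam hlam => ?_⟩
  simp_rw [HLmax_eq_ballMax]
  rw [ENNReal.ofReal_toReal hKt, div_eq_mul_inv K, mul_assoc]
  exact volume_setOf_lt_tsum_ballMax_le hd hr (fun h hh => lintegral_ballMax_rpow_le hd hr hh)
    (fun n => (hf n).abs.ennreal_ofReal) hfin.ne (by simpa using hlam) ENNReal.ofReal_ne_top
end
end
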